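/- For permutations σ ≤_R ρ in the right weak Bruhat order on S_n, either Q(σ) = Q(ρ) (i.e., σ and ρ are Knuth-equivalent after inverting, meaning P(σ) = P(ρ)), or the shape of the insertion tableau of ρ is strictly smaller than the shape of the insertion tableau of σ in the dominance order on partitions of n. -/

import Mathlib

/-- Schensted row insertion: insert `x` into a row, returning the new row and the
bumped entry (if any). -/
def insRow (x : ℕ) : List ℕ → List ℕ × Option ℕ
  | [] => ([x], none)
  | y :: ys =>
    if y ≤ x then
      let p := insRow x ys
      (y :: p.1, p.2)
    else (x :: ys, some y)

/-- Schensted insertion of an entry into a tableau (a list of rows). -/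
def insTab : List (List ℕ) → ℕ → List (List ℕ)
  | [], x => [[x]]
  | row :: rest, x =>
    match insRow x row with
    | (row', none) => row' :: rest
    | (row', some y) => row' :: insTab rest y

/-- The Robinson–Schensted insertion tableau `P(σ)` of a permutation, obtained by
inserting the one-line word of `σ` from left to right. -/
def Ptab {n : ℕ} (σ : Equiv.Perm (Fin n)) : List (List ℕ) :=
  (List.ofFn fun i => (σ i : ℕ)).foldl insTab []

/-- The shape of a tableau: the list of its row lengths. -/
def shapeOf (t : List (List ℕ)) : List ℕ := t.map List.length

/-- Dominance order on partitions (as lists): `domList a b` means `b` dominates `a`,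
i.e. every partial sum of `b` is at least the corresponding partial sum of `a`. -/
def domList (a b : List ℕ) : Prop := ∀ i, (a.take i).sum ≤ (b.take i).sum

/-- The right inversion set. -/
def InvR {n : ℕ} (σ : Equiv.Perm (Fin n)) : Set (Fin n × Fin n) :=
  {p | p.2 < p.1 ∧ σ⁻¹ p.1 < σ⁻¹ p.2}

/-- The right weak Bruhat order. -/
def rLE {n : ℕ} (σ ρ : Equiv.Perm (Fin n)) : Prop := InvR σ ⊆ InvR ρ



section
theorem exists_indep_rows {K : Type*} [Field K] {m n : Type*} [Fintype m] [Fintype n]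
    (M : Matrix m n K) (r : ℕ) (h : r ≤ M.rank) :
    ∃ f : Fin r → m, LinearIndependent K (fun i => M (f i)) := by
  classical
  rw [Matrix.rank_eq_finrank_span_row] at h
  obtain ⟨κ, a, ha, hs, hli⟩ := exists_linearIndependent' K M.row
  have : Fintype κ := Fintype.ofInjective a ha
  have hc : Fintype.card κ = Module.finrank K (Submodule.span K (Set.range M.row)) := by
    rw [← hs, finrank_span_eq_card hli]
  have : r ≤ Fintype.card κ := by omega
  obtain ⟨e⟩ : Nonempty (Fin r ↪ κ) := by
    apply Function.Embedding.nonempty_of_card_le; simpa using this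
  exact ⟨fun i => a (e i), hli.comp e e.injective⟩

theorem le_rank_iff_minor {K : Type*} [Field K] {m n : Type*} [Fintype m] [Fintype n]
    (M : Matrix m n K) (r : ℕ) :
    r ≤ M.rank ↔ ∃ (f : Fin r → m) (g : Fin r → n), (M.submatrix f g).det ≠ 0 := by
  classical
  constructor
  · intro h
    obtain ⟨f, hf⟩ := exists_indep_rows M r h
    have h1 : (M.submatrix f id).rank = r := by
      have := LinearIndependent.rank_matrix (M := M.submatrix f id) hf
      simpa using this
    have h2 : r ≤ (M.submatrix f id).transpose.rank := by rw [Matrix.rank_transpose]; omega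
    obtain ⟨g, hg⟩ := exists_indep_rows _ r h2
    refine ⟨f, g, ?_⟩
    have hu : LinearIndependent K ((M.submatrix f g).transpose).row := hg
    rw [Matrix.linearIndependent_rows_iff_isUnit, Matrix.isUnit_iff_isUnit_det,
      Matrix.det_transpose] at hu
    exact hu.ne_zero
  · rintro ⟨f, g, h⟩
    have h1 : (M.submatrix f g).rank = r := by
      rw [Matrix.rank_of_isUnit]
      · simp
      · rw [Matrix.isUnit_iff_isUnit_det]; exact isUnit_iff_ne_zero.2 h
    rw [← h1]
    exact Matrix.rank_submatrix_le M f g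

theorem rank_map_le_map {A K L : Type*} [CommRing A] [Field K] [Field L] {m n : Type*} [Fintype m]
    [Fintype n] (φ : A →+* K) (ψ : A →+* L) (hψ : Function.Injective ψ) (M : Matrix m n A) :
    (M.map φ).rank ≤ (M.map ψ).rank := by
  obtain ⟨f, g, h⟩ := (le_rank_iff_minor (M.map φ) _).1 le_rfl
  rw [le_rank_iff_minor]
  refine ⟨f, g, ?_⟩
  rw [Matrix.submatrix_map, ← RingHom.mapMatrix_apply, ← RingHom.map_det] at h ⊢
  intro h0
  rw [map_eq_zero_iff _ hψ] at h0
  simp [h0] at h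

theorem exists_spec {ι K : Type*} [Field K] {m n : Type*} [Fintype m]
    [Fintype n] (ψ : MvPolynomial ι ℚ →+* K)
    (M : Matrix m n (MvPolynomial ι ℚ)) :
    ∃ p : ι → ℚ, (M.map ψ).rank ≤ (M.map (MvPolynomial.eval p)).rank := by
  obtain ⟨f, g, h⟩ := (le_rank_iff_minor (M.map ψ) _).1 le_rfl
  rw [Matrix.submatrix_map, ← RingHom.mapMatrix_apply, ← RingHom.map_det] at h
  have h0 : (M.submatrix f g).det ≠ 0 := by rintro h0; simp [h0] at h
  obtain ⟨p, hp⟩ : ∃ p, MvPolynomial.eval p (M.submatrix f g).det ≠ 0 := by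
    by_contra! hh
    exact h0 (MvPolynomial.funext fun p => by simp [hh])
  refine ⟨p, (le_rank_iff_minor _ _).2 ⟨f, g, ?_⟩⟩
  rwa [Matrix.submatrix_map, ← RingHom.mapMatrix_apply, ← RingHom.map_det]
end


section
universe u

/-- The centralizer of an endomorphism, as a subspace. -/
def centr {K V : Type*} [Field K] [AddCommGroup V] [Module K V] (T : V →ₗ[K] V) :
    Submodule K (V →ₗ[K] V) where
  carrier := {φ | φ ∘ₗ T = T ∘ₗ φ}
  add_mem' := by
    intro a b ha hb
    simp only [Set.mem_ofPred_eq] at *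
    rw [LinearMap.add_comp, LinearMap.comp_add, ha, hb]
  zero_mem' := by simp
  smul_mem' := by
    intro c a ha
    simp only [Set.mem_ofPred_eq] at *
    rw [LinearMap.smul_comp, LinearMap.comp_smul, ha]

theorem mem_centr {K V : Type*} [Field K] [AddCommGroup V] [Module K V] {T φ : V →ₗ[K] V} :
    φ ∈ centr T ↔ ∀ v, φ (T v) = T (φ v) := by
  constructor
  · intro h v; exact LinearMap.congr_fun h v
  · intro h; exact LinearMap.ext h

/-- restriction of `T` to its range -/
def rtr {K V : Type*} [Field K] [AddCommGroup V] [Module K V] (T : V →ₗ[K] V) :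
    LinearMap.range T →ₗ[K] LinearMap.range T :=
  T.rangeRestrict ∘ₗ (LinearMap.range T).subtype

/-- restriction map of centralizers -/
def cres {K V : Type*} [Field K] [AddCommGroup V] [Module K V] (T : V →ₗ[K] V) :
    centr T →ₗ[K] centr (rtr T) where
  toFun φ := ⟨((φ : V →ₗ[K] V) ∘ₗ (LinearMap.range T).subtype).codRestrict (LinearMap.range T)
      (by
        rintro ⟨_, v, rfl⟩
        exact ⟨(φ : V →ₗ[K] V) v, (mem_centr.1 φ.2 v).symm⟩), by
        rw [mem_centr]
        rintro ⟨_, v, rfl⟩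
        apply Subtype.ext
        simpa [rtr] using mem_centr.1 φ.2 (T v)⟩
  map_add' := by intro a b; apply Subtype.ext; ext; simp
  map_smul' := by intro a b; apply Subtype.ext; ext; simp

theorem cres_apply {K V : Type*} [Field K] [AddCommGroup V] [Module K V] (T : V →ₗ[K] V)
    (φ : centr T) (u : LinearMap.range T) :
    (((cres T φ : centr (rtr T)) : LinearMap.range T →ₗ[K] LinearMap.range T) u : V)
      = (φ : V →ₗ[K] V) u := rfl

theorem rR_coe {K V : Type*} [Field K] [AddCommGroup V] [Module K V] (T : V →ₗ[K] V) (v : V) :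
    (T.rangeRestrict v : V) = T v := rfl

theorem cres_surj {K V : Type*} [Field K] [AddCommGroup V] [Module K V] (T : V →ₗ[K] V) :
    Function.Surjective (cres T) := by
  rintro ⟨φ, hφ⟩
  rw [mem_centr] at hφ
  obtain ⟨p, hp⟩ := (LinearMap.range T).subtype.exists_leftInverse_of_injective
    (Submodule.ker_subtype _)
  obtain ⟨h, hh⟩ := T.rangeRestrict.exists_rightInverse_of_surjective T.range_rangeRestrict
  have hp' : ∀ u : LinearMap.range T, p u = u := fun u => LinearMap.congr_fun hp u
  have hh' : ∀ u : LinearMap.range T, T (h u) = u := fun u =>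
    congrArg Subtype.val (LinearMap.congr_fun hh u)
  have hφ' : ∀ u : LinearMap.range T, (φ (T.rangeRestrict u) : V) = T (φ u) := fun u =>
    congrArg Subtype.val (hφ u)
  let Φ : V →ₗ[K] V := (LinearMap.range T).subtype ∘ₗ φ ∘ₗ p +
    h ∘ₗ φ ∘ₗ T.rangeRestrict ∘ₗ (LinearMap.id - (LinearMap.range T).subtype ∘ₗ p)
  have hΦ : ∀ v, Φ v = φ (p v) + h (φ (T.rangeRestrict (v - p v))) := fun v => rfl
  have hΦr : ∀ u : LinearMap.range T, Φ u = φ u := by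
    intro u; rw [hΦ, hp']; simp
  refine ⟨⟨Φ, ?_⟩, ?_⟩
  · rw [mem_centr]
    intro v
    have := hΦr (T.rangeRestrict v)
    rw [rR_coe] at this
    rw [this, hΦ, map_add, hh', ← hφ', map_sub, map_sub]
    simp
  · apply Subtype.ext
    apply LinearMap.ext
    intro u
    apply Subtype.ext
    rw [cres_apply]
    exact hΦr u

/-- kernel of the restriction map -/
def cker {K V : Type*} [Field K] [AddCommGroup V] [Module K V] (T : V →ₗ[K] V) :
    LinearMap.ker (cres T) ≃ₗ[K] ((V ⧸ LinearMap.range T) →ₗ[K] LinearMap.ker T) where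
  toFun φ := (LinearMap.range T).liftQ ((φ.1 : V →ₗ[K] V).codRestrict (LinearMap.ker T) (by
      intro v
      have h := φ.2
      rw [LinearMap.mem_ker] at h
      have h2 := congrArg Subtype.val (LinearMap.congr_fun (congrArg Subtype.val h)
        (T.rangeRestrict v))
      rw [cres_apply, rR_coe, mem_centr.1 φ.1.2] at h2
      simpa using h2)) (by
      rintro _ ⟨v, rfl⟩
      rw [LinearMap.mem_ker]
      apply Subtype.ext
      have h := φ.2
      rw [LinearMap.mem_ker] at h
      have h2 := congrArg Subtype.val (LinearMap.congr_fun (congrArg Subtype.val h)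
        (T.rangeRestrict v))
      rw [cres_apply, rR_coe] at h2
      simpa using h2)
  map_add' := by intro a b; apply LinearMap.ext; intro v; induction v using Submodule.Quotient.induction_on; rfl
  map_smul' := by intro a b; apply LinearMap.ext; intro v; induction v using Submodule.Quotient.induction_on; rfl
  invFun ψ := ⟨⟨(LinearMap.ker T).subtype ∘ₗ ψ ∘ₗ (LinearMap.range T).mkQ, by
      rw [mem_centr]
      intro v
      have h1 : (LinearMap.range T).mkQ (T v) = 0 := by
        rw [Submodule.mkQ_apply, Submodule.Quotient.mk_eq_zero]; exact ⟨v, rfl⟩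
      have h2 : T (ψ ((LinearMap.range T).mkQ v)) = 0 := (ψ ((LinearMap.range T).mkQ v)).2
      simp only [LinearMap.comp_apply, h1, Submodule.subtype_apply, h2]
      simp⟩, by
      rw [LinearMap.mem_ker]
      apply Subtype.ext
      apply LinearMap.ext
      rintro ⟨_, v, rfl⟩
      apply Subtype.ext
      rw [cres_apply]
      have h1 : (LinearMap.range T).mkQ (T v) = 0 := by
        rw [Submodule.mkQ_apply, Submodule.Quotient.mk_eq_zero]; exact ⟨v, rfl⟩
      simp only [LinearMap.comp_apply, h1]
      simp⟩
  left_inv := by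
    intro φ
    apply Subtype.ext; apply Subtype.ext; apply LinearMap.ext; intro v; rfl
  right_inv := by
    intro ψ
    apply LinearMap.ext; intro v; induction v using Submodule.Quotient.induction_on; rfl

theorem finrank_centr_eq {K V : Type*} [Field K] [AddCommGroup V] [Module K V]
    [FiniteDimensional K V] (T : V →ₗ[K] V) :
    Module.finrank K (centr T) = Module.finrank K (centr (rtr T)) +
      (Module.finrank K V - Module.finrank K (LinearMap.range T)) *
      (Module.finrank K V - Module.finrank K (LinearMap.range T)) := by
  have h1 := LinearMap.finrank_range_add_finrank_ker (K := K) (V := centr T) (V₂ := centr (rtr T)) (cres T)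
  rw [LinearMap.range_eq_top.2 (cres_surj T), finrank_top, (cker T).finrank_eq,
    Module.finrank_linearMap] at h1
  have h2 := LinearMap.finrank_range_add_finrank_ker T
  have h3 := (LinearMap.range T).finrank_quotient_add_finrank
  have h4 : Module.finrank K (LinearMap.ker T) =
    Module.finrank K V - Module.finrank K (LinearMap.range T) := by omega
  have h5 : Module.finrank K (V ⧸ LinearMap.range T) =
    Module.finrank K V - Module.finrank K (LinearMap.range T) := by omega
  rw [h4, h5] at h1
  exact h1.symm

theorem rtr_pow {K V : Type*} [Field K] [AddCommGroup V] [Module K V] (T : V →ₗ[K] V) (j : ℕ)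
    (u : LinearMap.range T) : (((rtr T)^j) u : V) = (T^j) u := by
  induction j generalizing u with
  | zero => rfl
  | succ j ih => rw [pow_succ, Module.End.mul_apply, ih, pow_succ, Module.End.mul_apply]; rfl

theorem finrank_range_rtr {K V : Type*} [Field K] [AddCommGroup V] [Module K V]
    (T : V →ₗ[K] V) (j : ℕ) :
    Module.finrank K (LinearMap.range ((rtr T)^j)) =
      Module.finrank K (LinearMap.range (T^(j+1))) := by
  have : (LinearMap.range ((rtr T)^j)).map (LinearMap.range T).subtype =
      LinearMap.range (T^(j+1)) := by
    ext x
    constructor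
    · rintro ⟨_, ⟨⟨_, v, rfl⟩, rfl⟩, rfl⟩
      refine ⟨v, ?_⟩
      rw [Submodule.subtype_apply, rtr_pow, pow_succ]; rfl
    · rintro ⟨v, rfl⟩
      refine ⟨_, ⟨⟨T v, v, rfl⟩, rfl⟩, ?_⟩
      rw [Submodule.subtype_apply, rtr_pow, pow_succ]; rfl
  rw [← this]
  exact (Submodule.equivMapOfInjective _ Subtype.val_injective _).finrank_eq

theorem fr_zero {K V : Type*} [Field K] [AddCommGroup V] [Module K V] (T : V →ₗ[K] V) :
    Module.finrank K (LinearMap.range (T ^ 0)) = Module.finrank K V := by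
  have : LinearMap.range (T ^ 0) = ⊤ := LinearMap.range_id
  rw [this, finrank_top]

theorem finrank_centr_congr {K : Type*} [Field K] (d : ℕ) : ∀ {V W : Type u}
    [AddCommGroup V] [Module K V] [FiniteDimensional K V]
    [AddCommGroup W] [Module K W] [FiniteDimensional K W]
    (T : V →ₗ[K] V) (S : W →ₗ[K] W), IsNilpotent T → IsNilpotent S → Module.finrank K V ≤ d → 
    (∀ j, Module.finrank K (LinearMap.range (T^j)) = Module.finrank K (LinearMap.range (S^j))) →
    Module.finrank K (centr T) = Module.finrank K (centr S) := by
  induction d with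
  | zero =>
    intro V W _ _ _ _ _ _ T S hT hS hd hj
    have h0 := hj 0
    rw [fr_zero, fr_zero] at h0
    have : Module.finrank K (V →ₗ[K] V) = 0 := by rw [Module.finrank_linearMap]; simp; omega
    have h2 : Module.finrank K (W →ₗ[K] W) = 0 := by rw [Module.finrank_linearMap]; simp; omega
    have h3 := Submodule.finrank_le (centr T)
    have h4 := Submodule.finrank_le (centr S)
    omega
  | succ d ih =>
    intro V W _ _ _ _ _ _ T S hT hS hd hj
    have h0 := hj 0
    have h1 := hj 1
    rw [fr_zero, fr_zero] at h0
    rw [pow_one, pow_one] at h1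
    rw [finrank_centr_eq T, finrank_centr_eq S, h0, h1]
    congr 1
    obtain ⟨a, ha⟩ := hT
    obtain ⟨b, hb⟩ := hS
    apply ih
    · refine ⟨a, ?_⟩
      apply LinearMap.ext; intro u; apply Subtype.ext; rw [rtr_pow, ha]; rfl
    · refine ⟨b, ?_⟩
      apply LinearMap.ext; intro u; apply Subtype.ext; rw [rtr_pow, hb]; rfl
    · by_contra hcon
      have h5 : LinearMap.range T = ⊤ := by
        apply Submodule.eq_top_of_finrank_eq
        have := Submodule.finrank_le (LinearMap.range T)
        omega
      have h6 : ∀ j, LinearMap.range (T^j) = ⊤ := by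
        intro j
        induction j with
        | zero => exact LinearMap.range_id
        | succ j ihj =>
          rw [pow_succ', Module.End.mul_eq_comp, LinearMap.range_comp, ihj, Submodule.map_top, h5]
      have h7 := h6 a
      rw [ha, LinearMap.range_zero] at h7
      have : Module.finrank K V = 0 := by
        rw [← finrank_top, ← h7, finrank_bot]
      have := Submodule.finrank_le (LinearMap.range T)
      omega
    · intro j
      rw [finrank_range_rtr, finrank_range_rtr, hj]
end


section
/-- The abstract step of Lemma D. -/
theorem comm_step {K V : Type*} [Field K] [AddCommGroup V] [Module K V] (T : V →ₗ[K] V)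
    (hT : IsNilpotent T) (D : V → V) (hD : ∀ u v, D (u + v) = D u + D v)
    (hDT : ∀ v, D (T v) = T (D v)) (w : V) :
    ∃ φ : V →ₗ[K] V, (∀ v, φ (T v) = T (φ v)) ∧ ∃ a, φ w = D w + T a := by
  classical
  have hD0 : D 0 = 0 := by have := hD 0 0; simpa using this
  have hDp : ∀ j v, D ((T ^ j) v) = (T ^ j) (D v) := by
    intro j
    induction j with
    | zero => intro v; rfl
    | succ j ih => intro v; rw [pow_succ, Module.End.mul_apply, ih, hDT]; rfl
  have hex : ∃ m, ∃ w1 w2, w = w1 + T w2 ∧ (T ^ m) w1 = 0 := by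
    obtain ⟨a, ha⟩ := hT
    exact ⟨a, w, 0, by simp, by simp [ha]⟩
  set m := Nat.find hex with hm
  obtain ⟨w1, w2, hw, hw1⟩ := Nat.find_spec hex
  rw [← hm] at hw1
  have hmin : ∀ k < m, ¬ ∃ w1 w2, w = w1 + T w2 ∧ (T ^ k) w1 = 0 := fun k hk =>
    Nat.find_min hex hk
  clear_value m
  rcases m with _ | m
  · refine ⟨0, by simp, - D w2, ?_⟩
    have : w1 = 0 := by simpa using hw1
    rw [hw, this, zero_add, hDT]; simp
  · have hnot : (T ^ m) w1 ∉ LinearMap.range (T ^ (m + 1)) := by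
      rintro ⟨u, hu⟩
      refine hmin m (Nat.lt_succ_self m) ⟨w1 - T u, w2 + u, by rw [hw, map_add]; abel, ?_⟩
      rw [map_sub, ← hu, pow_succ]; simp
    obtain ⟨l, hl0, hl1⟩ := Submodule.exists_le_ker_of_notMem hnot
    have hl1' : ∀ u, l ((T ^ (m + 1)) u) = 0 := fun u => hl1 ⟨u, rfl⟩
    set c := l ((T ^ m) w1) with hc
    set v := D w1 with hv
    have hTv : (T ^ (m + 1)) v = 0 := by rw [hv, ← hDp, hw1, hD0]
    let φ : V →ₗ[K] V := ∑ j ∈ Finset.range (m + 1),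
      (c⁻¹ • (l ∘ₗ (T ^ (m - j)))).smulRight ((T ^ j) v)
    have hφ : ∀ u, φ u = ∑ j ∈ Finset.range (m + 1), (c⁻¹ * l ((T ^ (m - j)) u)) • (T ^ j) v := by
      intro u; simp [φ, LinearMap.sum_apply]
    have hcomm : ∀ u, φ (T u) = T (φ u) := by
      intro u
      rw [hφ, hφ, map_sum, Finset.sum_range_succ', Finset.sum_range_succ]
      have e1 : (T ^ (m - 0)) (T u) = (T ^ (m + 1)) u := by rw [pow_succ]; rfl
      have e2 : T ((c⁻¹ * l ((T ^ (m - m)) u)) • (T ^ m) v) = 0 := by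
        rw [map_smul]
        have : T ((T ^ m) v) = (T ^ (m + 1)) v := by rw [pow_succ']; rfl
        rw [this, hTv, smul_zero]
      rw [e1, hl1', e2]
      simp only [mul_zero, zero_smul, add_zero]
      refine Finset.sum_congr rfl fun j hj => ?_
      rw [Finset.mem_range] at hj
      rw [map_smul]
      have e3 : (T ^ (m - (j + 1))) (T u) = (T ^ (m - j)) u := by
        have : m - j = (m - (j + 1)) + 1 := by omega
        rw [this, pow_succ]; rfl
      have e4 : (T ^ (j + 1)) v = T ((T ^ j) v) := by rw [pow_succ']; rfl
      rw [e3, e4]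
    refine ⟨φ, hcomm, ?_⟩
    have h1 : φ w1 = v + T (∑ j ∈ Finset.range m, (c⁻¹ * l ((T ^ (m - (j + 1))) w1)) • (T ^ j) v) := by
      rw [hφ, Finset.sum_range_succ', map_sum, add_comm]
      congr 1
      · simp only [Nat.sub_zero, ← hc, pow_zero, inv_mul_cancel₀ hl0, one_smul]; rfl
      · refine Finset.sum_congr rfl fun j hj => ?_
        rw [map_smul, pow_succ']; rfl
    refine ⟨(∑ j ∈ Finset.range m, (c⁻¹ * l ((T ^ (m - (j + 1))) w1)) • (T ^ j) v)
      + φ w2 - D w2, ?_⟩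
    have h2 : φ w = φ w1 + T (φ w2) := by rw [hw, map_add, hcomm]
    have h3 : D w = v + T (D w2) := by rw [hw, hD, hDT]
    rw [h2, h3, h1, map_sub, map_add]; abel

open Matrix

theorem map_der_mul {K : Type*} [CommRing K] {l m n : Type*} [Fintype m] (d : Derivation ℤ K K)
    (A : Matrix l m K) (B : Matrix m n K) :
    (A * B).map d = A.map d * B + A * B.map d := by
  ext i j
  simp only [Matrix.map_apply, Matrix.mul_apply, Matrix.add_apply, map_sum, Derivation.leibniz,
    smul_eq_mul, ← Finset.sum_add_distrib]
  exact Finset.sum_congr rfl fun x _ => by ring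

theorem map_der_mulVec {K : Type*} [CommRing K] {m n : Type*} [Fintype n] (d : Derivation ℤ K K)
    (A : Matrix m n K) (v : n → K) :
    (fun i => d ((A *ᵥ v) i)) = A.map d *ᵥ v + A *ᵥ (fun i => d (v i)) := by
  ext i
  simp only [Matrix.mulVec, dotProduct, Pi.add_apply, Matrix.map_apply, map_sum,
    Derivation.leibniz, smul_eq_mul, ← Finset.sum_add_distrib]
  exact Finset.sum_congr rfl fun x _ => by ring

theorem map_der_sub {K : Type*} [CommRing K] {m n : Type*} (d : Derivation ℤ K K)
    (A B : Matrix m n K) : (A - B).map d = A.map d - B.map d := by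
  ext i j; simp

theorem map_der_add {K : Type*} [CommRing K] {m n : Type*} (d : Derivation ℤ K K)
    (A B : Matrix m n K) : (A + B).map d = A.map d + B.map d := by
  ext i j; simp

theorem der_trace {K : Type*} [CommRing K] {n : Type*} [Fintype n] (d : Derivation ℤ K K)
    (A : Matrix n n K) : d A.trace = (A.map d).trace := by
  simp [Matrix.trace]

theorem strictUpper_pow {K : Type*} [CommRing K] {n : ℕ} (N : Matrix (Fin n) (Fin n) K)
    (hN : ∀ i j, j ≤ i → N i j = 0) (k : ℕ) (i j : Fin n) (h : (j : ℕ) < i + k) :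
    (N ^ k) i j = 0 := by
  induction k generalizing j with
  | zero => rw [pow_zero, Matrix.one_apply_ne]; intro h0; subst h0; omega
  | succ k ih =>
    rw [pow_succ, Matrix.mul_apply]
    refine Finset.sum_eq_zero fun x _ => ?_
    by_cases hx : (x : ℕ) < i + k
    · rw [ih x hx, zero_mul]
    · rw [hN x j (by rw [Fin.le_def]; omega), mul_zero]

theorem strictUpper_nilp {K : Type*} [CommRing K] {n : ℕ} (N : Matrix (Fin n) (Fin n) K)
    (hN : ∀ i j, j ≤ i → N i j = 0) : IsNilpotent N := by
  refine ⟨n, ?_⟩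
  ext i j
  rw [strictUpper_pow N hN n i j (by omega)]; rfl

theorem trace_mul_comm_nilp {K : Type*} [Field K] {n : ℕ} (N Z : Matrix (Fin n) (Fin n) K)
    (hN : IsNilpotent N) (h : N * Z = Z * N) : (N * Z).trace = 0 := by
  have h1 : IsNilpotent (N * Z) := Commute.isNilpotent_mul_right h hN
  exact (Matrix.isNilpotent_trace_of_isNilpotent h1).eq_zero

theorem lemmaD_aux {K : Type*} [Field K] {n : ℕ} (d : Derivation ℤ K K)
    (N : Matrix (Fin n) (Fin n) K) (hN : ∀ i j, j ≤ i → N i j = 0) (k : ℕ) (hk : k ≤ n) :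
    ∃ Y : Matrix (Fin n) (Fin n) K, (∀ i j : Fin n, ¬ ((i : ℕ) < k ∧ (j : ℕ) < k) → Y i j = 0) ∧
      (Matrix.of fun i j : Fin n => if (j : ℕ) < k then N i j else 0).map d =
        Y * (Matrix.of fun i j : Fin n => if (j : ℕ) < k then N i j else 0)
        - (Matrix.of fun i j : Fin n => if (j : ℕ) < k then N i j else 0) * Y ∧
      ((Matrix.of fun i j : Fin n => if (j : ℕ) < k then N i j else 0) * Y).trace = 0 := by
  induction k with
  | zero =>
    refine ⟨0, by simp, ?_, by simp⟩
    ext i j; simp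
  | succ k ih =>
    obtain ⟨Y, hY, hd, ht⟩ := ih (by omega)
    set T : Matrix (Fin n) (Fin n) K :=
      Matrix.of fun i j : Fin n => if (j : ℕ) < k then N i j else 0 with hT
    let e : Fin n := ⟨k, by omega⟩
    let w : Fin n → K := fun i => N i e
    let P : Matrix (Fin n) (Fin n) K := Matrix.diagonal fun i => if (i : ℕ) < k then 1 else 0
    have hTu : ∀ i j, j ≤ i → T i j = 0 := by
      intro i j hij; simp [hT, hN i j hij]
    have hTn : IsNilpotent T := strictUpper_nilp T hTu
    have hPT : P * T = T := by
      ext i j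
      simp only [P, Matrix.diagonal_mul, hT, Matrix.of_apply]
      split_ifs with h1 h2
      · simp
      · simp
      · rw [hN i j (by rw [Fin.le_def]; omega)]; simp
      · simp
    have hTP : T * P = T := by
      ext i j
      simp only [P, Matrix.mul_diagonal, hT, Matrix.of_apply]
      split_ifs <;> simp
    have hPY : P * Y = Y := by
      ext i j
      simp only [P, Matrix.diagonal_mul]
      split_ifs with h1
      · simp
      · rw [hY i j (by tauto)]; simp
    have hPw : ∀ u : Fin n → K, (∀ i : Fin n, k ≤ (i : ℕ) → u i = 0) → P *ᵥ u = u := by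
      intro u hu
      ext i
      simp only [P, Matrix.mulVec_diagonal]
      split_ifs with h1
      · simp
      · rw [hu i (by omega)]; simp
    have hw : ∀ i : Fin n, k ≤ (i : ℕ) → w i = 0 := fun i hi => hN i e hi
    let D : (Fin n → K) → (Fin n → K) := fun u => (fun i => d (u i)) - Y *ᵥ u
    have hD : ∀ u v, D (u + v) = D u + D v := by
      intro u v; ext i; simp [D, Matrix.mulVec_add]; ring
    have hDT : ∀ v, D (T.mulVecLin v) = T.mulVecLin (D v) := by
      intro v
      simp only [D, Matrix.mulVecLin_apply, map_der_mulVec, hd, Matrix.sub_mulVec,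
        Matrix.mulVec_sub, Matrix.mulVec_mulVec]
      abel
    have hTl : IsNilpotent T.mulVecLin := by
      obtain ⟨a, ha⟩ := hTn
      refine ⟨a, ?_⟩
      have : (Matrix.toLinAlgEquiv' T) ^ a = 0 := by rw [← map_pow, ha, map_zero]
      exact this
    obtain ⟨φ, hφ, a, ha⟩ := comm_step T.mulVecLin hTl D hD hDT w
    obtain ⟨F, rfl⟩ : ∃ F : Matrix (Fin n) (Fin n) K, F.mulVecLin = φ :=
      ⟨LinearMap.toMatrix' φ, by rw [← Matrix.toLin'_apply', Matrix.toLin'_toMatrix']⟩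
    have hFT : F * T = T * F := by
      have : (F * T).mulVecLin = (T * F).mulVecLin := by
        apply LinearMap.ext; intro v
        simpa [Matrix.mulVec_mulVec] using hφ v
      rw [← Matrix.toLin'_apply', ← Matrix.toLin'_apply'] at this
      exact Matrix.toLin'.injective this
    simp only [Matrix.mulVecLin_apply] at ha
    set Z := P * F * P with hZ
    have hZT : Z * T = T * Z := by
      calc Z * T = P * (F * T) := by rw [hZ, Matrix.mul_assoc, hPT, Matrix.mul_assoc]
        _ = T * F := by rw [hFT, ← Matrix.mul_assoc, hPT]
        _ = (F * T) * P := by rw [Matrix.mul_assoc, hTP, hFT]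
        _ = T * Z := by rw [hFT, hZ, Matrix.mul_assoc P, ← Matrix.mul_assoc T P, hTP, Matrix.mul_assoc]
    have hDw : P *ᵥ D w = D w := by
      apply hPw
      intro i hi
      simp only [D, Pi.sub_apply, hw i hi, map_zero, zero_sub, neg_eq_zero, Matrix.mulVec, dotProduct]
      exact Finset.sum_eq_zero fun j _ => by rw [hY i j (by omega), zero_mul]
    set ζ := P *ᵥ a with hζ
    have hTζ : T *ᵥ ζ = T *ᵥ a := by rw [hζ, Matrix.mulVec_mulVec, hTP]
    have hZw : Z *ᵥ w = D w + T *ᵥ ζ := by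
      rw [hZ, ← Matrix.mulVec_mulVec, hPw w hw, ← Matrix.mulVec_mulVec, ha, Matrix.mulVec_add, hDw,
        Matrix.mulVec_mulVec, hPT, hTζ]
    have hdw : (fun i => d (w i)) = (Y + Z) *ᵥ w - T *ᵥ ζ := by
      rw [Matrix.add_mulVec, hZw]; simp only [D]; abel
    have hN' : (Matrix.of fun i j : Fin n => if (j : ℕ) < k + 1 then N i j else 0) =
        T + Matrix.vecMulVec w (Pi.single e 1) := by
      ext i j
      simp only [hT, Matrix.of_apply, Matrix.add_apply, Matrix.vecMulVec_apply]
      by_cases hj : j = e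
      · subst hj; simp [e, w]
      · have : (j : ℕ) ≠ k := fun h => hj (Fin.ext h)
        rw [Pi.single_eq_of_ne hj]
        by_cases h1 : (j : ℕ) < k
        · simp [h1, Nat.lt_succ_of_lt h1]
        · have h2 : ¬ (j : ℕ) < k + 1 := by omega
          simp [h1, h2]
    have e1 : (Pi.single e 1 : Fin n → K) ᵥ* T = 0 := by
      ext j
      rw [Matrix.single_one_vecMul]
      simp only [hT, Matrix.row_apply, Matrix.of_apply, Pi.zero_apply]
      split_ifs with h
      · exact hN e j (le_of_lt h)
      · rfl
    have hYe : ∀ j, Y e j = 0 := fun j => hY e j (by simp [e])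
    have hZe : ∀ j, Z e j = 0 := by
      intro j; simp [hZ, P, Matrix.mul_assoc, Matrix.diagonal_mul, e]
    have e2 : (Pi.single e 1 : Fin n → K) ᵥ* (Y + Z) = 0 := by
      ext j
      rw [Matrix.single_one_vecMul]
      simp [hYe, hZe]
    have e3 : (Pi.single e 1 : Fin n → K) ⬝ᵥ w = 0 := by
      rw [single_one_dotProduct]; exact hw e le_rfl
    have e4 : (Pi.single e 1 : Fin n → K) ⬝ᵥ ζ = 0 := by
      rw [single_one_dotProduct, hζ]; simp [P, Matrix.mulVec_diagonal, e]
    have hTY : (T + Matrix.vecMulVec w (Pi.single e 1)) *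
        (Y + Z + Matrix.vecMulVec ζ (Pi.single e 1)) =
        T * Y + T * Z + Matrix.vecMulVec (T *ᵥ ζ) (Pi.single e 1) := by
      rw [Matrix.mul_add, Matrix.add_mul, Matrix.vecMulVec_mul, e2, Matrix.add_mul,
        Matrix.vecMulVec_mul_vecMulVec, e4, Matrix.mul_vecMulVec, Matrix.mul_add]
      simp
    refine ⟨Y + Z + Matrix.vecMulVec ζ (Pi.single e 1), ?_, ?_, ?_⟩
    · intro i j hij
      have h1 : Y i j = 0 := hY i j (by omega)
      have h2 : Z i j = 0 := by
        simp only [hZ, P, Matrix.mul_assoc, Matrix.diagonal_mul, Matrix.mul_diagonal]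
        split_ifs <;> simp <;> omega
      have h3 : ζ i * (Pi.single e 1 : Fin n → K) j = 0 := by
        by_cases hj : j = e
        · subst hj
          have : ¬ (i : ℕ) < k := by
            intro h; apply hij; simp [e]; omega
          simp [hζ, P, Matrix.mulVec_diagonal, this]
        · rw [Pi.single_eq_of_ne hj, mul_zero]
      simp [h1, h2, Matrix.vecMulVec_apply, h3]
    · rw [hN', hTY, map_der_add, hd]
      have h5 : (Matrix.vecMulVec w (Pi.single e 1)).map d =
          Matrix.vecMulVec (fun i => d (w i)) (Pi.single e 1) := by
        ext i j
        simp only [Matrix.map_apply, Matrix.vecMulVec_apply]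
        by_cases hj : j = e
        · subst hj; simp
        · rw [Pi.single_eq_of_ne hj]; simp
      rw [h5, hdw, Matrix.add_mul, Matrix.vecMulVec_mul, Matrix.vecMul_add, e1,
        Matrix.vecMul_vecMulVec, e3, Matrix.mul_add, Matrix.mul_vecMulVec, Matrix.add_mul, hZT,
        Matrix.sub_vecMulVec]
      simp
      abel
    · rw [hN', hTY, Matrix.trace_add, Matrix.trace_add, ht,
        trace_mul_comm_nilp T Z hTn hZT.symm, Matrix.trace_vecMulVec, dotProduct_comm,
        Matrix.dotProduct_mulVec, e1]
      simp

theorem lemmaD {K : Type*} [Field K] {n : ℕ} (d : Derivation ℤ K K)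
    (N : Matrix (Fin n) (Fin n) K) (hN : ∀ i j, j ≤ i → N i j = 0) :
    ∃ Y : Matrix (Fin n) (Fin n) K, N.map d = Y * N - N * Y ∧ (N * Y).trace = 0 := by
  obtain ⟨Y, _, h2, h3⟩ := lemmaD_aux d N hN n le_rfl
  have : (Matrix.of fun i j : Fin n => if (j : ℕ) < n then N i j else 0) = N := by
    ext i j; simp
  rw [this] at h2 h3
  exact ⟨Y, h2, h3⟩

theorem isotropy {K : Type*} [Field K] {n : ℕ} (d1 d2 : Derivation ℤ K K)
    (hc : ∀ a, d1 (d2 a) = d2 (d1 a))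
    (N Y1 Y2 : Matrix (Fin n) (Fin n) K) (hN : ∀ i j, j ≤ i → N i j = 0)
    (h1 : N.map d1 = Y1 * N - N * Y1) (t1 : (N * Y1).trace = 0)
    (h2 : N.map d2 = Y2 * N - N * Y2) (t2 : (N * Y2).trace = 0) :
    (N.map d1 * Y2).trace = 0 := by
  have hcc : (N.map d2).map d1 = (N.map d1).map d2 := by ext i j; simp [hc]
  rw [h1, h2, map_der_sub, map_der_sub, map_der_mul, map_der_mul, map_der_mul, map_der_mul,
    h1, h2] at hcc
  set U := Y2.map d1
  set V := Y1.map d2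
  have hW : N * (U - V - (Y1 * Y2 - Y2 * Y1)) = (U - V - (Y1 * Y2 - Y2 * Y1)) * N := by
    have h := sub_eq_zero.2 hcc
    rw [← sub_eq_zero, ← neg_eq_zero, ← h]
    noncomm_ring
  have h3 := trace_mul_comm_nilp N _ (strictUpper_nilp N hN) hW
  have h4 := congrArg d1 t2
  have h5 := congrArg d2 t1
  rw [der_trace, map_der_mul, h1, map_zero] at h4
  rw [der_trace, map_der_mul, h2, map_zero] at h5
  rw [h1]
  simp only [Matrix.mul_sub, Matrix.sub_mul, Matrix.trace_add, Matrix.trace_sub] at h3 h4 h5 ⊢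
  have c1 : (Y1 * N * Y2).trace = (N * (Y2 * Y1)).trace := by
    rw [Matrix.mul_assoc, Matrix.trace_mul_comm, Matrix.mul_assoc]
  have c2 : (Y2 * N * Y1).trace = (N * (Y1 * Y2)).trace := by
    rw [Matrix.mul_assoc, Matrix.trace_mul_comm, Matrix.mul_assoc]
  rw [Matrix.mul_assoc N] at h4 h5 ⊢
  rw [c1] at h4 ⊢
  rw [c2] at h5
  linear_combination (-1 : K) * h3 + h4 - h5
end


section
open Matrix

theorem exists_der_ext {A K : Type*} [CommRing A] [IsDomain A] [Field K] [Algebra A K]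
    [IsFractionRing A K] (d : Derivation ℤ A A) :
    ∃ d' : Derivation ℤ K K, ∀ a, d' (algebraMap A K a) = algebraMap A K (d a) := by
  let f : A →+* TrivSqZeroExt K K :=
    { toFun := fun a => TrivSqZeroExt.inl (algebraMap A K a) + TrivSqZeroExt.inr (algebraMap A K (d a))
      map_one' := by ext <;> simp
      map_zero' := by ext <;> simp
      map_mul' := by
        intro a b
        ext
        · simp
        · simp only [TrivSqZeroExt.snd_add, TrivSqZeroExt.snd_inl, TrivSqZeroExt.snd_inr,
            TrivSqZeroExt.snd_mul, TrivSqZeroExt.fst_add, TrivSqZeroExt.fst_inl,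
            TrivSqZeroExt.fst_inr, zero_add, add_zero, Derivation.leibniz, map_add, map_mul,
            smul_eq_mul, op_smul_eq_smul]
      map_add' := by intro a b; ext <;> simp [Algebra.smul_def] }
  have hu : ∀ y : nonZeroDivisors A, IsUnit (f y) := by
    intro y
    rw [TrivSqZeroExt.isUnit_iff_isUnit_fst]
    have : (f y).fst = algebraMap A K y := by simp [f]
    rw [this]
    exact IsLocalization.map_units K y
  let g : K →+* TrivSqZeroExt K K := IsLocalization.lift (M := nonZeroDivisors A) hu
  have hg : ∀ a, g (algebraMap A K a) = f a := fun a => IsLocalization.lift_eq hu a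
  have hfst : ∀ x, (g x).fst = x := by
    have : ((TrivSqZeroExt.fstHom K K K).toRingHom.comp g) = RingHom.id K := by
      apply IsLocalization.ringHom_ext (nonZeroDivisors A)
      ext a
      simp [hg, f]
    intro x
    exact RingHom.congr_fun this x
  refine ⟨Derivation.mk' (AddMonoidHom.toIntLinearMap
    { toFun := fun x => (g x).snd, map_zero' := by simp, map_add' := by simp }) ?_, ?_⟩
  · intro a b
    change (g (a * b)).snd = a • (g b).snd + b • (g a).snd
    rw [map_mul, TrivSqZeroExt.snd_mul, hfst, hfst]
    simp [mul_comm]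
  · intro a
    change (g (algebraMap A K a)).snd = _
    rw [hg]
    change (TrivSqZeroExt.inl (algebraMap A K a) +
      TrivSqZeroExt.inr (algebraMap A K (d a)) : TrivSqZeroExt K K).snd = _
    rw [TrivSqZeroExt.snd_add, TrivSqZeroExt.snd_inl, TrivSqZeroExt.snd_inr, zero_add]

theorem der_eq_zero {A K : Type*} [CommRing A] [IsDomain A] [Field K] [Algebra A K]
    [IsFractionRing A K] (D : Derivation ℤ K K) (h : ∀ a, D (algebraMap A K a) = 0) (x : K) :
    D x = 0 := by
  obtain ⟨a, b, hb, rfl⟩ := IsFractionRing.div_surjective (A := A) x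
  have hb0 : algebraMap A K b ≠ 0 := by
    simpa using nonZeroDivisors.ne_zero hb
  have h1 : D (algebraMap A K a / algebraMap A K b * algebraMap A K b) = 0 := by
    rw [div_mul_cancel₀ _ hb0, h]
  rw [Derivation.leibniz, h b] at h1
  simpa [hb0] using h1

theorem der_ext_comm {A K : Type*} [CommRing A] [IsDomain A] [Field K] [Algebra A K]
    [IsFractionRing A K] (d1 d2 : Derivation ℤ A A) (hc : ∀ a, d1 (d2 a) = d2 (d1 a))
    (D1 D2 : Derivation ℤ K K) (h1 : ∀ a, D1 (algebraMap A K a) = algebraMap A K (d1 a))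
    (h2 : ∀ a, D2 (algebraMap A K a) = algebraMap A K (d2 a)) (x : K) :
    D1 (D2 x) = D2 (D1 x) := by
  have := der_eq_zero (A := A) ⁅D1, D2⁆ (by
    intro a; rw [Derivation.commutator_apply, h1, h2, h1, h2, hc, sub_self]) x
  rw [Derivation.commutator_apply, sub_eq_zero] at this
  exact this

/-- `X ↦ X N - N X` -/
def adm {K : Type*} [CommRing K] {n : ℕ} (N : Matrix (Fin n) (Fin n) K) :
    Matrix (Fin n) (Fin n) K →ₗ[K] Matrix (Fin n) (Fin n) K :=
  LinearMap.mulRight K N - LinearMap.mulLeft K N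

theorem adm_apply {K : Type*} [CommRing K] {n : ℕ} (N X : Matrix (Fin n) (Fin n) K) :
    adm N X = X * N - N * X := rfl

theorem trace_adm {K : Type*} [CommRing K] {n : ℕ} (N X Y : Matrix (Fin n) (Fin n) K) :
    (X * adm N Y).trace = - (adm N X * Y).trace := by
  rw [adm_apply, adm_apply, Matrix.mul_sub, Matrix.sub_mul, Matrix.trace_sub, Matrix.trace_sub,
    Matrix.mul_assoc N X Y, Matrix.trace_mul_comm N, Matrix.mul_assoc X Y N, Matrix.mul_assoc X N Y]
  ring

open Classical in
/-- generators of the space `[b, N] + S` -/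
noncomputable def gen {K : Type*} [CommRing K] {n : ℕ} (N : Matrix (Fin n) (Fin n) K)
    (R : Fin n → Fin n → Prop) :
    (Fin n × Fin n) ⊕ (Fin n × Fin n) → Matrix (Fin n) (Fin n) K
  | Sum.inl p => if p.1 ≤ p.2 then adm N (Matrix.single p.1 p.2 1) else 0
  | Sum.inr p => if R p.1 p.2 then Matrix.single p.1 p.2 1 else 0

/-- matrix of generators -/
noncomputable def genM {K : Type*} [CommRing K] {n : ℕ} (N : Matrix (Fin n) (Fin n) K)
    (R : Fin n → Fin n → Prop) :
    Matrix ((Fin n × Fin n) ⊕ (Fin n × Fin n)) (Fin n × Fin n) K :=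
  Matrix.of fun a p => gen N R a p.1 p.2

theorem finrank_span_gen {K : Type*} [Field K] {n : ℕ} (N : Matrix (Fin n) (Fin n) K)
    (R : Fin n → Fin n → Prop) :
    Module.finrank K (Submodule.span K (Set.range (gen N R))) = (genM N R).rank := by
  let e : Matrix (Fin n) (Fin n) K ≃ₗ[K] (Fin n × Fin n → K) :=
    (LinearEquiv.curry K K (Fin n) (Fin n)).symm
  rw [Matrix.rank_eq_finrank_span_row, ← e.finrank_map_eq, Submodule.map_span, ← Set.range_comp]
  rfl

/-- orthogonal complement for the trace form -/
def perp {K ι : Type*} [Field K] {n : ℕ} (v : ι → Matrix (Fin n) (Fin n) K) :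
    Submodule K (Matrix (Fin n) (Fin n) K) where
  carrier := {X | ∀ a, (X * v a).trace = 0}
  add_mem' := by
    intro a b ha hb i
    rw [Matrix.add_mul, Matrix.trace_add, ha i, hb i, add_zero]
  zero_mem' := by intro i; simp
  smul_mem' := by
    intro c a ha i
    rw [Matrix.smul_mul, Matrix.trace_smul, ha i, smul_zero]

theorem mem_perp {K ι : Type*} [Field K] {n : ℕ} {v : ι → Matrix (Fin n) (Fin n) K}
    {X : Matrix (Fin n) (Fin n) K} : X ∈ perp v ↔ ∀ a, (X * v a).trace = 0 := Iff.rfl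

theorem finrank_perp {K : Type*} [Field K] {n : ℕ} (N : Matrix (Fin n) (Fin n) K)
    (R : Fin n → Fin n → Prop) :
    Module.finrank K (perp (gen N R)) + (genM N R).rank = n * n := by
  let e : Matrix (Fin n) (Fin n) K ≃ₗ[K] (Fin n × Fin n → K) :=
    (Matrix.transposeLinearEquiv (Fin n) (Fin n) K K).trans (LinearEquiv.curry K K (Fin n) (Fin n)).symm
  have h1 : (perp (gen N R)).map (e : _ →ₗ[K] _) = LinearMap.ker (genM N R).mulVecLin := by
    ext x
    obtain ⟨X, rfl⟩ := e.surjective x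
    rw [Submodule.mem_map_equiv, LinearEquiv.symm_apply_apply, mem_perp, LinearMap.mem_ker,
      funext_iff]
    refine forall_congr' fun a => ?_
    have : (genM N R).mulVecLin (e X) a = (X * gen N R a).trace := by
      simp only [Matrix.mulVecLin_apply, Matrix.mulVec, dotProduct, Matrix.trace, Matrix.diag,
        Matrix.mul_apply, Fintype.sum_prod_type]
      rw [Finset.sum_comm]
      refine Finset.sum_congr rfl fun i _ => Finset.sum_congr rfl fun j _ => ?_
      rw [mul_comm]; rfl
    rw [this]; rfl
  have h2 := LinearMap.finrank_range_add_finrank_ker (genM N R).mulVecLin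
  rw [← h1, e.finrank_map_eq] at h2
  have h3 : Module.finrank K (LinearMap.range (genM N R).mulVecLin) = (genM N R).rank := rfl
  rw [h3] at h2
  simp at h2
  omega

theorem finrank_ker_adm {K : Type*} [Field K] {n : ℕ} (N : Matrix (Fin n) (Fin n) K) :
    Module.finrank K (LinearMap.ker (adm N)) = Module.finrank K (centr N.mulVecLin) := by
  have : (LinearMap.ker (adm N)).map (Matrix.toLin' : _ ≃ₗ[K] _).toLinearMap = centr N.mulVecLin := by
    ext x
    obtain ⟨X, rfl⟩ := (Matrix.toLin' : Matrix (Fin n) (Fin n) K ≃ₗ[K] _).surjective x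
    rw [Submodule.mem_map_equiv, LinearEquiv.symm_apply_apply, LinearMap.mem_ker, adm_apply,
      sub_eq_zero]
    change _ ↔ Matrix.toLin' X ∘ₗ Matrix.toLin' N = Matrix.toLin' N ∘ₗ Matrix.toLin' X
    rw [← Matrix.toLin'_mul, ← Matrix.toLin'_mul]
    exact (Matrix.toLin' : Matrix (Fin n) (Fin n) K ≃ₗ[K] _).injective.eq_iff.symm
  rw [← this, LinearEquiv.finrank_map_eq]

theorem finrank_comap_eq {K V W : Type*} [Field K] [AddCommGroup V] [Module K V] [AddCommGroup W]
    [Module K W] [FiniteDimensional K V] (f : V →ₗ[K] W) (M : Submodule K W) :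
    Module.finrank K (M.comap f) =
      Module.finrank K (M ⊓ LinearMap.range f : Submodule K W) + Module.finrank K (LinearMap.ker f) := by
  have h := LinearMap.finrank_range_add_finrank_ker (f.domRestrict (M.comap f))
  have h1 : LinearMap.range (f.domRestrict (M.comap f)) = M ⊓ LinearMap.range f := by
    rw [LinearMap.range_domRestrict, Submodule.map_comap_eq, inf_comm]
  have h2 : (LinearMap.ker (f.domRestrict (M.comap f))).map (M.comap f).subtype = LinearMap.ker f := by
    ext x
    simp only [Submodule.mem_map, LinearMap.mem_ker, Subtype.exists, Submodule.mem_comap]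
    constructor
    · rintro ⟨a, ha, h3, rfl⟩; exact h3
    · intro h3; exact ⟨x, by rw [h3]; exact M.zero_mem, h3, rfl⟩
  rw [h1, (Submodule.equivMapOfInjective _ (M.comap f).injective_subtype _).finrank_eq, h2] at h
  exact h.symm

theorem coiso {K : Type*} [Field K] {n : ℕ} (N : Matrix (Fin n) (Fin n) K)
    (R : Fin n → Fin n → Prop) (pos : Fin n → Fin n)
    (hR : ∀ i j, R i j ↔ i < j ∧ pos i < pos j) (hN : ∀ i j, ¬ R i j → N i j = 0) :
    n * n ≤ 2 * (genM N R).rank + Module.finrank K (centr N.mulVecLin) := by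
  have hNu : ∀ i j, j ≤ i → N i j = 0 := fun i j hij => hN i j fun h =>
    absurd ((hR i j).1 h).1 (not_lt.2 hij)
  have key : perp (gen N R) ≤ (Submodule.span K (Set.range (gen N R))).comap (adm N) := by
    intro X hX
    rw [mem_perp] at hX
    rw [Submodule.mem_comap]
    have hX1 : ∀ i j, j ≤ i → adm N X i j = 0 := by
      intro i j hij
      have h := hX (Sum.inl (j, i))
      simp only [gen, hij, if_true] at h
      rw [trace_adm, neg_eq_zero, Matrix.trace_mul_single] at h
      simpa using h
    have hX2 : ∀ i j, R i j → X j i = 0 := by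
      intro i j hij
      have h := hX (Sum.inr (i, j))
      simp only [gen, hij, if_true] at h
      rw [Matrix.trace_mul_single] at h
      simpa using h
    let B1 : Matrix (Fin n) (Fin n) K := Matrix.of fun i j => if i ≤ j then X i j else 0
    let B2 : Matrix (Fin n) (Fin n) K := Matrix.of fun i j => if i ≤ j then 0 else X i j
    have hB : X = B1 + B2 := by
      ext i j; simp only [B1, B2, Matrix.add_apply, Matrix.of_apply]; split_ifs <;> simp
    have hB1 : adm N B1 ∈ Submodule.span K (Set.range (gen N R)) := by
      rw [Matrix.matrix_eq_sum_single B1, map_sum]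
      refine Submodule.sum_mem _ fun i _ => ?_
      rw [map_sum]
      refine Submodule.sum_mem _ fun j _ => ?_
      by_cases hij : i ≤ j
      · have : Matrix.single i j (B1 i j) = B1 i j • Matrix.single i j (1 : K) := by simp
        rw [this, map_smul]
        refine Submodule.smul_mem _ _ (Submodule.subset_span ⟨Sum.inl (i, j), ?_⟩)
        simp [gen, hij]
      · have : B1 i j = 0 := by simp [B1, hij]
        rw [this]; simp
    have hB1u : ∀ i j, j ≤ i → adm N B1 i j = 0 := by
      intro i j hij
      rw [adm_apply, Matrix.sub_apply, Matrix.mul_apply, Matrix.mul_apply,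
        Finset.sum_eq_zero, Finset.sum_eq_zero, sub_zero]
      · intro x _
        by_cases h1 : x ≤ i
        · rw [hNu i x h1, zero_mul]
        · have : ¬ x ≤ j := fun h => h1 (h.trans hij)
          simp [B1, this]
      · intro x _
        by_cases h1 : i ≤ x
        · rw [hNu x j (hij.trans h1), mul_zero]
        · simp [B1, h1]
    have hB2p : ∀ i j, B2 i j ≠ 0 → pos i ≤ pos j := by
      intro i j hij
      by_contra hlt
      apply hij
      simp only [B2, Matrix.of_apply]
      split_ifs with h
      · rfl
      · exact hX2 j i ((hR j i).2 ⟨not_le.1 h, not_le.1 hlt⟩)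
    have hNp : ∀ i j, N i j ≠ 0 → pos i < pos j := by
      intro i j hij
      by_contra hlt
      exact hij (hN i j fun h => hlt ((hR i j).1 h).2)
    have hB2u : ∀ i j, ¬ R i j → adm N B2 i j = 0 := by
      intro i j hij
      by_cases h1 : j ≤ i
      · have h2 := hX1 i j h1
        rw [hB, map_add, Matrix.add_apply, hB1u i j h1, zero_add] at h2
        exact h2
      · have h2 : ¬ pos i < pos j := fun h => hij ((hR i j).2 ⟨not_le.1 h1, h⟩)
        rw [adm_apply, Matrix.sub_apply, Matrix.mul_apply, Matrix.mul_apply,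
          Finset.sum_eq_zero, Finset.sum_eq_zero, sub_zero]
        · intro x _
          by_contra h3
          exact h2 ((hNp i x (left_ne_zero_of_mul h3)).trans_le (hB2p x j (right_ne_zero_of_mul h3)))
        · intro x _
          by_contra h3
          exact h2 ((hB2p i x (left_ne_zero_of_mul h3)).trans_lt (hNp x j (right_ne_zero_of_mul h3)))
    rw [hB, map_add]
    refine Submodule.add_mem _ hB1 ?_
    rw [Matrix.matrix_eq_sum_single (adm N B2)]
    refine Submodule.sum_mem _ fun i _ => Submodule.sum_mem _ fun j _ => ?_
    by_cases hij : R i j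
    · have : Matrix.single i j (adm N B2 i j) = adm N B2 i j • Matrix.single i j (1 : K) := by simp
      rw [this]
      refine Submodule.smul_mem _ _ (Submodule.subset_span ⟨Sum.inr (i, j), ?_⟩)
      simp [gen, hij]
    · rw [hB2u i j hij]; simp
  have h1 := Submodule.finrank_mono key
  rw [finrank_comap_eq, finrank_ker_adm] at h1
  have h2 := finrank_perp N R
  have h3 : Module.finrank K (Submodule.span K (Set.range (gen N R)) ⊓ LinearMap.range (adm N) :
    Submodule K (Matrix (Fin n) (Fin n) K)) ≤ (genM N R).rank := by
    rw [← finrank_span_gen]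
    exact Submodule.finrank_mono inf_le_left
  omega

theorem iso {K : Type*} [Field K] {n : ℕ} (N : Matrix (Fin n) (Fin n) K)
    (R : Fin n → Fin n → Prop) (hR : ∀ i j, R i j → i < j)
    (hN : ∀ i j, j ≤ i → N i j = 0) (d : Fin n × Fin n → Derivation ℤ K K)
    (hd : ∀ p q x, d p (d q x) = d q (d p x)) (c : Fin n × Fin n → K)
    (hc : ∀ p, R p.1 p.2 → c p ≠ 0)
    (hdN : ∀ p, R p.1 p.2 → N.map (d p) = c p • Matrix.single p.1 p.2 1) :
    2 * (genM N R).rank + Module.finrank K (centr N.mulVecLin) ≤ n * n := by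
  classical
  choose Y hY1 hY2 using fun p => lemmaD (d p) N hN
  let pre : (Fin n × Fin n) ⊕ (Fin n × Fin n) → Matrix (Fin n) (Fin n) K
    | Sum.inl p => if p.1 ≤ p.2 then Matrix.single p.1 p.2 1 else 0
    | Sum.inr p => if R p.1 p.2 then (c p)⁻¹ • Y p else 0
  have hpre : ∀ a, gen N R a = adm N (pre a) := by
    rintro (p | p)
    · simp only [gen, pre]; split_ifs <;> simp
    · simp only [gen, pre]
      split_ifs with h
      · rw [map_smul, adm_apply, ← hY1, hdN p h, smul_smul, inv_mul_cancel₀ (hc p h), one_smul]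
      · simp
  have hup : ∀ i j (X : Matrix (Fin n) (Fin n) K), i ≤ j → (∀ i j, j ≤ i → X i j = 0) →
      (Matrix.single i j 1 * X).trace = 0 := by
    intro i j X hij hX
    rw [Matrix.trace_mul_comm, Matrix.trace_mul_single, hX j i hij]; simp
  have hgu : ∀ a i j, j ≤ i → gen N R a i j = 0 := by
    rintro (p | p) i j hij
    · simp only [gen]
      split_ifs with h
      · rw [adm_apply, Matrix.sub_apply, Matrix.mul_apply, Matrix.mul_apply,
          Finset.sum_eq_zero, Finset.sum_eq_zero, sub_zero]
        · intro x _
          rw [Matrix.single_apply]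
          split_ifs with h1
          · rw [hN i x (by rw [← h1.1]; exact h.trans (h1.2.le.trans hij)), zero_mul]
          · simp
        · intro x _
          rw [Matrix.single_apply]
          split_ifs with h1
          · rw [hN x j (by rw [← h1.2]; exact hij.trans (h1.1 ▸ h)), mul_zero]
          · simp
      · rfl
    · simp only [gen]
      split_ifs with h
      · rw [Matrix.single_apply, if_neg]
        rintro ⟨h1, h2⟩
        have := hR _ _ h
        rw [h1, h2] at this
        exact absurd this (not_lt.2 hij)
      · rfl
  have hprep : ∀ a, pre a ∈ perp (gen N R) := by
    intro a
    rw [mem_perp]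
    intro b
    rcases a with p | p
    · simp only [pre]
      split_ifs with h
      · exact hup _ _ _ h (hgu b)
      · simp
    · rcases b with q | q
      · rw [hpre, trace_adm, ← hpre (Sum.inr p), neg_eq_zero, Matrix.trace_mul_comm]
        simp only [pre]
        split_ifs with h
        · exact hup _ _ _ h (hgu _)
        · simp
      · simp only [pre, gen]
        split_ifs with h1 h2
        · have := isotropy (d q) (d p) (hd q p) N (Y q) (Y p) hN (hY1 q) (hY2 q) (hY1 p) (hY2 p)
          rw [hdN q h2, Matrix.smul_mul, Matrix.trace_smul, smul_eq_mul, mul_eq_zero,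
            or_iff_right (hc q h2), Matrix.trace_mul_comm] at this
          rw [Matrix.smul_mul, Matrix.trace_smul, this, smul_zero]
        · simp
        · simp
        · simp
  have hspan : Submodule.span K (Set.range (gen N R)) =
      (Submodule.span K (Set.range pre)).map (adm N) := by
    rw [Submodule.map_span, ← Set.range_comp]
    congr 2
    funext a
    exact hpre a
  have key : (Submodule.span K (Set.range (gen N R))).comap (adm N) ≤ perp (gen N R) := by
    intro X hX
    rw [Submodule.mem_comap, hspan, Submodule.mem_map] at hX
    obtain ⟨X', hX', he⟩ := hX
    have h1 : X' ∈ perp (gen N R) := by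
      refine Submodule.span_le.2 ?_ hX'
      rintro _ ⟨a, rfl⟩
      exact hprep a
    have h2 : X - X' ∈ perp (gen N R) := by
      rw [mem_perp]
      intro a
      rw [hpre, trace_adm, map_sub, he, sub_self]; simp
    have := Submodule.add_mem _ h1 h2
    simpa using this
  have h1 := Submodule.finrank_mono key
  rw [finrank_comap_eq, finrank_ker_adm, inf_eq_left.2, finrank_span_gen] at h1
  · have h2 := finrank_perp N R
    omega
  · rw [hspan]; exact LinearMap.map_le_range
end


section
open Matrix

theorem cramer_lattice {A K ι κ : Type*} [CommRing A] [IsDomain A] [Field K] [Algebra A K]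
    [IsFractionRing A K] [Fintype ι] [Fintype κ] (s : A →+* A) (G : Matrix ι κ A) (u : κ → A)
    (W : Submodule K (κ → K)) (hG : ∀ a, (fun p => algebraMap A K (G a p)) ∈ W)
    (hu : (fun p => algebraMap A K (u p)) ∈ W)
    (hW : Module.finrank K W ≤ (G.map ((algebraMap A K).comp s)).rank) :
    ∃ q, s q ≠ 0 ∧ ∃ c : ι → A, ∀ p, q * u p = ∑ a, c a * G a p := by
  classical
  set r := (G.map ((algebraMap A K).comp s)).rank with hr
  obtain ⟨f, g, hfg⟩ := (le_rank_iff_minor (G.map ((algebraMap A K).comp s)) r).1 le_rfl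
  rw [Matrix.submatrix_map, ← RingHom.mapMatrix_apply, ← RingHom.map_det, RingHom.comp_apply] at hfg
  set B := G.submatrix f g with hB
  have hsq : s B.det ≠ 0 := by intro h; rw [h, map_zero] at hfg; exact hfg rfl
  have hq0 : B.det ≠ 0 := by intro h; rw [h, map_zero] at hsq; exact hsq rfl
  have hinj := IsFractionRing.injective A K
  have hq : algebraMap A K B.det ≠ 0 := by
    intro h; exact hq0 ((map_eq_zero_iff _ hinj).1 h)
  let v : Fin r → κ → K := fun i p => algebraMap A K (G (f i) p)
  have hli : LinearIndependent K v := by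
    have h1 : LinearIndependent K (B.map (algebraMap A K)).row := by
      rw [Matrix.linearIndependent_rows_iff_isUnit, Matrix.isUnit_iff_isUnit_det,
        ← RingHom.mapMatrix_apply, ← RingHom.map_det]
      exact isUnit_iff_ne_zero.2 hq
    exact LinearIndependent.of_comp (LinearMap.funLeft K K g) h1
  have hsp : Submodule.span K (Set.range v) = W := by
    apply Submodule.eq_of_le_of_finrank_le
    · rw [Submodule.span_le]; rintro _ ⟨i, rfl⟩; exact hG (f i)
    · rw [finrank_span_eq_card hli]; simpa using hW
  rw [← hsp, Submodule.mem_span_range_iff_exists_fun] at hu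
  obtain ⟨κ', hκ⟩ := hu
  let c' : Fin r → A := (fun i => u (g i)) ᵥ* B.adjugate
  have hc' : ∀ i, algebraMap A K (c' i) = algebraMap A K B.det * κ' i := by
    have h1 : (fun i => algebraMap A K (u (g i))) = κ' ᵥ* (B.map (algebraMap A K)) := by
      ext j
      have := congrFun hκ (g j)
      simp only [Finset.sum_apply, Pi.smul_apply, smul_eq_mul] at this
      rw [← this]; rfl
    have h2 : (fun i => algebraMap A K (c' i)) =
        (fun i => algebraMap A K (u (g i))) ᵥ* (B.adjugate.map (algebraMap A K)) := by
      ext j; simp [c', Matrix.vecMul, dotProduct]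
    have h3 : B.map (algebraMap A K) * B.adjugate.map (algebraMap A K) =
        algebraMap A K B.det • (1 : Matrix (Fin r) (Fin r) K) := by
      rw [← Matrix.map_mul, Matrix.mul_adjugate]
      ext i j
      by_cases hij : i = j
      · subst hij; simp
      · simp [hij]
    rw [h1, Matrix.vecMul_vecMul, h3, Matrix.vecMul_smul, Matrix.vecMul_one] at h2
    intro i
    exact congrFun h2 i
  refine ⟨B.det, hsq, fun a => ∑ i, if f i = a then c' i else 0, fun p => ?_⟩
  have h4 : ∑ a, (∑ i, if f i = a then c' i else 0) * G a p = ∑ i, c' i * G (f i) p := by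
    simp_rw [Finset.sum_mul]
    rw [Finset.sum_comm]
    refine Finset.sum_congr rfl fun i _ => ?_
    simp [ite_mul]
  rw [h4]
  apply hinj
  rw [map_mul, map_sum]
  have := congrFun hκ p
  simp only [Finset.sum_apply, Pi.smul_apply, smul_eq_mul] at this
  rw [← this, Finset.mul_sum]
  refine Finset.sum_congr rfl fun i _ => ?_
  rw [map_mul, hc']; ring

theorem minors_mul_left {B l m n : Type*} [CommRing B] [Fintype m] (I : Ideal B)
    (Y : Matrix l m B) (W : Matrix m n B) (r : ℕ)
    (h : ∀ (f : Fin r → m) (g : Fin r → n), (W.submatrix f g).det ∈ I)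
    (f : Fin r → l) (g : Fin r → n) : ((Y * W).submatrix f g).det ∈ I := by
  classical
  have h1 : ((Y * W).submatrix f g) = fun i => ∑ a, Y (f i) a • (fun j => W a (g j)) := by
    ext i j
    simp [Matrix.mul_apply, Finset.sum_apply]
  change (Matrix.detRowAlternating (R := B) (n := Fin r)).toMultilinearMap _ ∈ I
  rw [h1, MultilinearMap.map_sum]
  refine Ideal.sum_mem _ fun k _ => ?_
  rw [MultilinearMap.map_smul_univ]
  exact Ideal.mul_mem_left _ _ (h k g)

theorem minors_mul_right {B l m n : Type*} [CommRing B] [Fintype m] (I : Ideal B)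
    (W : Matrix l m B) (Z : Matrix m n B) (r : ℕ)
    (h : ∀ (f : Fin r → l) (g : Fin r → m), (W.submatrix f g).det ∈ I)
    (f : Fin r → l) (g : Fin r → n) : ((W * Z).submatrix f g).det ∈ I := by
  have := minors_mul_left I Zᵀ Wᵀ r (fun f g => by
    rw [← Matrix.transpose_submatrix, Matrix.det_transpose]; exact h g f) g f
  rw [← Matrix.transpose_mul, ← Matrix.transpose_submatrix, Matrix.det_transpose] at this
  exact this

theorem minors_der {A l m : Type*} [CommRing A] [Fintype l] [Fintype m]
    (D : Derivation ℤ A A) (W : Matrix l m A) (Y : Matrix l l A) (Z : Matrix m m A)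
    (hD : W.map D = Y * W - W * Z) (x : A) (r : ℕ)
    (h : ∀ (f : Fin r → l) (g : Fin r → m), x ∣ (W.submatrix f g).det)
    (f : Fin r → l) (g : Fin r → m) : x ∣ D (W.submatrix f g).det := by
  classical
  let i : A →+* TrivSqZeroExt A A := TrivSqZeroExt.inlHom A A
  let φ : A →+* TrivSqZeroExt A A :=
    { toFun := fun a => TrivSqZeroExt.inl a + TrivSqZeroExt.inr (D a)
      map_one' := by ext <;> simp
      map_zero' := by ext <;> simp
      map_mul' := by
        intro a b
        ext
        · simp
        · simp only [TrivSqZeroExt.snd_add, TrivSqZeroExt.snd_inl, TrivSqZeroExt.snd_inr,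
            TrivSqZeroExt.snd_mul, TrivSqZeroExt.fst_add, TrivSqZeroExt.fst_inl,
            TrivSqZeroExt.fst_inr, zero_add, add_zero, Derivation.leibniz, map_add, map_mul,
            smul_eq_mul, op_smul_eq_smul]
      map_add' := by
        intro a b
        ext
        · simp
        · simp only [TrivSqZeroExt.snd_add, TrivSqZeroExt.snd_inl, TrivSqZeroExt.snd_inr, map_add,
            zero_add] }
  have hφ : ∀ a, (φ a).snd = D a := by
    intro a
    change (TrivSqZeroExt.inl a + TrivSqZeroExt.inr (D a) : TrivSqZeroExt A A).snd = _
    rw [TrivSqZeroExt.snd_add, TrivSqZeroExt.snd_inl, TrivSqZeroExt.snd_inr, zero_add]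
  let ε : TrivSqZeroExt A A := TrivSqZeroExt.inr 1
  have hεε : ε * ε = 0 := TrivSqZeroExt.inr_mul_inr _ _ _
  have hφi : ∀ a, φ a = i a + ε * i (D a) := by
    intro a
    change TrivSqZeroExt.inl a + TrivSqZeroExt.inr (D a) =
      TrivSqZeroExt.inl a + TrivSqZeroExt.inr 1 * TrivSqZeroExt.inl (D a)
    rw [TrivSqZeroExt.inr_mul_inl]
    simp
  have hW : W.map φ = (1 + ε • Y.map i) * W.map i * (1 - ε • Z.map i) := by
    have h1 : W.map φ = W.map i + ε • (W.map D).map i := by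
      ext1 a b; simp only [Matrix.map_apply, Matrix.add_apply, Matrix.smul_apply, hφi, smul_eq_mul]
    have h2 : (W.map D).map i = Y.map i * W.map i - W.map i * Z.map i := by
      rw [hD, Matrix.map_sub _ (fun a b => map_sub i a b), Matrix.map_mul, Matrix.map_mul]
    rw [h1, h2]
    simp only [Matrix.add_mul, Matrix.mul_sub, Matrix.one_mul, Matrix.mul_one, Matrix.smul_mul,
      Matrix.mul_smul, smul_add, smul_sub]
    have h0 : ∀ M : Matrix l m (TrivSqZeroExt A A), ε • ε • M = 0 := by
      intro M; rw [smul_smul, hεε, zero_smul]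
    rw [h0]
    abel
  have h3 : ∀ (f : Fin r → l) (g : Fin r → m),
      ((W.map i).submatrix f g).det ∈ Ideal.span {i x} := by
    intro f g
    rw [Matrix.submatrix_map, ← RingHom.mapMatrix_apply, ← RingHom.map_det,
      Ideal.mem_span_singleton]
    exact map_dvd i (h f g)
  have h4 := minors_mul_right _ _ (1 - ε • Z.map i) r
    (minors_mul_left _ (1 + ε • Y.map i) _ r h3) f g
  rw [← hW, Matrix.submatrix_map, ← RingHom.mapMatrix_apply, ← RingHom.map_det,
      Ideal.mem_span_singleton] at h4
  obtain ⟨z, hz⟩ := h4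
  refine ⟨z.snd, ?_⟩
  rw [← hφ, hz, TrivSqZeroExt.snd_mul]
  simp [i]

theorem minors_vanish {A l m : Type*} [CommRing A] [IsDomain A] [WfDvdMonoid A] [Algebra ℚ A]
    [Fintype l] [Fintype m] (D : Derivation ℤ A A) (W : Matrix l m A) (Y : Matrix l l A)
    (Z : Matrix m m A) (hD : W.map D = Y * W - W * Z) (t : A) (ht : Prime t) (hDt : ¬ t ∣ D t)
    (r : ℕ) (h : ∀ (f : Fin r → l) (g : Fin r → m), t ∣ (W.submatrix f g).det)
    (f : Fin r → l) (g : Fin r → m) : (W.submatrix f g).det = 0 := by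
  classical
  by_contra h0
  have hex : ∃ k, ¬ ∀ (f : Fin r → l) (g : Fin r → m), t ^ k ∣ (W.submatrix f g).det := by
    obtain ⟨k, hk⟩ := FiniteMultiplicity.of_not_isUnit ht.not_isUnit h0
    exact ⟨k + 1, fun h => hk (h f g)⟩
  have hk := Nat.find_spec hex
  have hmin : ∀ j < Nat.find hex, _ := fun j hj => Nat.find_min hex hj
  set k := Nat.find hex
  clear_value k
  rcases k with _ | _ | k
  · simp at hk
  · simp at hk; obtain ⟨f, g, hk⟩ := hk; exact hk (h f g)
  have h1 := not_not.1 (hmin (k + 1) (by omega))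
  push Not at hk
  obtain ⟨f', g', hk⟩ := hk
  obtain ⟨F, hF⟩ := h1 f' g'
  have htF : ¬ t ∣ F := by
    intro hd
    apply hk
    rw [hF, pow_succ]
    exact mul_dvd_mul_left _ hd
  have h2 := minors_der D W Y Z hD _ r h1 f' g'
  rw [hF, Derivation.leibniz, Derivation.leibniz_pow] at h2
  simp only [smul_eq_mul, nsmul_eq_mul] at h2
  rw [dvd_add_right (Dvd.intro _ rfl)] at h2
  have h3 : t ^ k * t ∣ t ^ k * (((k + 1 : ℕ) : A) * D t * F) := by
    rw [← pow_succ]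
    refine h2.trans (dvd_of_eq ?_)
    rw [Nat.add_sub_cancel]; ring
  have h4 := (mul_dvd_mul_iff_left (pow_ne_zero k ht.ne_zero)).1 h3
  rcases ht.dvd_or_dvd h4 with h5 | h5
  · rcases ht.dvd_or_dvd h5 with h6 | h6
    · have hu : IsUnit ((k + 1 : ℕ) : A) := by
        have : ((k + 1 : ℕ) : A) = algebraMap ℚ A ((k + 1 : ℕ) : ℚ) := by simp
        rw [this]
        exact (isUnit_iff_ne_zero.2 (by positivity)).map _
      exact ht.not_isUnit (isUnit_of_dvd_unit h6 hu)
    · exact hDt h6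
  · exact htF h5
end


section
open Matrix

/-- coefficient ring -/
abbrev PolA (n : ℕ) : Type := MvPolynomial (Option (Fin n × Fin n)) ℚ

/-- its fraction field -/
abbrev KK (n : ℕ) : Type := FractionRing (PolA n)

open Classical in
/-- the generic deformation -/
noncomputable def Nt {n : ℕ} (Rs Rr : Fin n → Fin n → Prop) : Matrix (Fin n) (Fin n) (PolA n) :=
  Matrix.of fun i j => if Rr i j then MvPolynomial.X (some (i, j)) else
    if Rs i j then MvPolynomial.X none * MvPolynomial.X (some (i, j)) else 0

/-- specialization at `t = 0` -/
noncomputable def sp (n : ℕ) : PolA n →+* PolA n :=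
  (MvPolynomial.aeval (R := ℚ)
    (fun o : Option (Fin n × Fin n) => o.elim (0 : PolA n) (fun p => MvPolynomial.X (some p)))).toRingHom

theorem sp_none (n : ℕ) : sp n (MvPolynomial.X none) = 0 := by
  simp [sp]

theorem sp_some (n : ℕ) (p : Fin n × Fin n) :
    sp n (MvPolynomial.X (some p)) = MvPolynomial.X (some p) := by
  simp [sp]

theorem sp_C (n : ℕ) (a : ℚ) : sp n (MvPolynomial.C a) = MvPolynomial.C a := by
  simp [sp]

theorem dvd_sub_sp {n : ℕ} (f : PolA n) : (MvPolynomial.X none : PolA n) ∣ f - sp n f := by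
  induction f using MvPolynomial.induction_on with
  | C a => rw [sp_C, sub_self]; exact dvd_zero _
  | add p q hp hq =>
    rw [map_add, add_sub_add_comm]; exact dvd_add hp hq
  | mul_X p i hp =>
    rw [map_mul]
    have : p * MvPolynomial.X i - sp n p * sp n (MvPolynomial.X i) =
      (p - sp n p) * MvPolynomial.X i + sp n p * (MvPolynomial.X i - sp n (MvPolynomial.X i)) := by
      ring
    rw [this]
    refine dvd_add (hp.mul_right _) (Dvd.dvd.mul_left ?_ _)
    rcases i with _ | i
    · rw [sp_none, sub_zero]
    · rw [sp_some, sub_self]; exact dvd_zero _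

theorem dvd_of_sp {n : ℕ} (f : PolA n) (h : sp n f = 0) : (MvPolynomial.X none : PolA n) ∣ f := by
  have := dvd_sub_sp f
  rwa [h, sub_zero] at this

/-- projection on the first `k` coordinates -/
def Pm (K : Type*) [CommRing K] (n k : ℕ) : Matrix (Fin n) (Fin n) K :=
  Matrix.diagonal fun i => if (i : ℕ) < k then 1 else 0

theorem Pm_map {K L : Type*} [CommRing K] [CommRing L] (φ : K →+* L) (n k : ℕ) :
    (Pm K n k).map φ = Pm L n k := by
  rw [Pm, Matrix.diagonal_map (map_zero φ), Pm]
  congr 1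
  funext i
  by_cases h : (i : ℕ) < k <;> simp [h]

theorem powP_map {K L : Type*} [CommRing K] [CommRing L] (φ : K →+* L) {n : ℕ} (k j : ℕ)
    (N : Matrix (Fin n) (Fin n) K) : (N ^ j * Pm K n k).map φ = (N.map φ) ^ j * Pm L n k := by
  rw [Matrix.map_mul, Pm_map]
  congr 1
  exact map_pow φ.mapMatrix N j

theorem upper_Pm {K : Type*} [CommRing K] {n k : ℕ} (Y : Matrix (Fin n) (Fin n) K)
    (hY : ∀ i j, j < i → Y i j = 0) : Pm K n k * (Y * Pm K n k) = Y * Pm K n k := by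
  ext i j
  simp only [Pm, Matrix.diagonal_mul, Matrix.mul_diagonal]
  split_ifs with h1 h2 h2
  · simp
  · simp
  · rw [hY i j (by rw [Fin.lt_def]; omega)]; simp
  · simp

theorem der_pow {A : Type*} [CommRing A] {n : ℕ} (D : Derivation ℤ A A)
    (N Y : Matrix (Fin n) (Fin n) A) (h : N.map D = Y * N - N * Y) (j : ℕ) :
    (N ^ j).map D = Y * N ^ j - N ^ j * Y := by
  induction j with
  | zero =>
    rw [pow_zero, Matrix.mul_one, Matrix.one_mul, sub_self]
    ext a b
    by_cases hab : a = b
    · subst hab; simp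
    · simp [hab]
  | succ j ih =>
    rw [pow_succ, map_der_mul, ih, h]
    noncomm_ring

theorem der_powP {A : Type*} [CommRing A] {n : ℕ} (D : Derivation ℤ A A)
    (N Y : Matrix (Fin n) (Fin n) A) (h : N.map D = Y * N - N * Y)
    (hY : ∀ i j, j < i → Y i j = 0) (j k : ℕ) :
    (N ^ j * Pm A n k).map D = Y * (N ^ j * Pm A n k) - (N ^ j * Pm A n k) * (Y * Pm A n k) := by
  have h0 : (Pm A n k).map D = 0 := by
    ext a b
    by_cases hab : a = b
    · subst hab; simp only [Pm, Matrix.map_apply, Matrix.diagonal_apply_eq]; split_ifs <;> simp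
    · simp [Pm, hab]
  rw [map_der_mul, h0, Matrix.mul_zero, add_zero, der_pow D N Y h, Matrix.mul_assoc (N ^ j),
    upper_Pm Y hY, Matrix.sub_mul, Matrix.mul_assoc, Matrix.mul_assoc]

/-- partial derivatives -/
noncomputable def pd {n : ℕ} (o : Option (Fin n × Fin n)) : Derivation ℤ (PolA n) (PolA n) :=
  (MvPolynomial.pderiv (R := ℚ) o).restrictScalars ℤ

theorem pd_apply {n : ℕ} (o : Option (Fin n × Fin n)) (f : PolA n) :
    pd o f = MvPolynomial.pderiv o f := rfl

theorem pd_comm {n : ℕ} (o o' : Option (Fin n × Fin n)) (f : PolA n) :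
    pd o (pd o' f) = pd o' (pd o f) := by
  classical
  simp only [pd_apply]
  have : ⁅MvPolynomial.pderiv (R := ℚ) o, MvPolynomial.pderiv (R := ℚ) o'⁆ = 0 := by
    apply MvPolynomial.derivation_ext
    intro i
    rw [Derivation.commutator_apply, MvPolynomial.pderiv_X, MvPolynomial.pderiv_X]
    by_cases h1 : i = o <;> by_cases h2 : i = o' <;> (simp [Pi.single_apply, h1, h2]; try (split_ifs <;> simp))
  have h2 := congrArg (fun D => D f) this
  simp only [Derivation.commutator_apply] at h2
  exact sub_eq_zero.mp h2

open Classical in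
theorem pd_some_Nt {n : ℕ} (Rs Rr : Fin n → Fin n → Prop) (hrs : ∀ i j, Rr i j → Rs i j)
    (p : Fin n × Fin n)
    (hp : Rs p.1 p.2) : (Nt Rs Rr).map (pd (some p)) =
      (if Rr p.1 p.2 then (1 : PolA n) else MvPolynomial.X none) • Matrix.single p.1 p.2 1 := by
  ext1 i j
  simp only [Nt, Matrix.map_apply, Matrix.of_apply, Matrix.smul_apply, Matrix.single_apply, pd_apply]
  by_cases hij : p = (i, j)
  · subst hij
    by_cases h1 : Rr i j
    · simp [h1]
    · have h2 : Rs i j := hp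
      simp [h1, h2, Derivation.leibniz]
  · have h3 : ¬ (p.1 = i ∧ p.2 = j) := fun h => hij (Prod.ext h.1 h.2)
    have h4 : (some (i, j) : Option (Fin n × Fin n)) ≠ some p := by simpa using fun h => hij h.symm
    rw [if_neg h3]
    split_ifs
    · rw [MvPolynomial.pderiv_X_of_ne h4]; simp
    · rw [MvPolynomial.pderiv_X_of_ne h4]; simp
    · rw [Derivation.leibniz, MvPolynomial.pderiv_X_of_ne h4, MvPolynomial.pderiv_X_of_ne (by simp)]; simp
    · rw [Derivation.leibniz, MvPolynomial.pderiv_X_of_ne h4, MvPolynomial.pderiv_X_of_ne (by simp)]; simp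
    · simp
    · simp

open Classical in
theorem pd_none_Nt {n : ℕ} (Rs Rr : Fin n → Fin n → Prop) (i j : Fin n) :
    pd none (Nt Rs Rr i j) = if Rr i j then 0 else
      if Rs i j then MvPolynomial.X (some (i, j)) else 0 := by
  simp only [Nt, Matrix.of_apply, pd_apply]
  split_ifs
  · rw [MvPolynomial.pderiv_X_of_ne (by simp)]
  · rw [Derivation.leibniz, MvPolynomial.pderiv_X_of_ne (by simp)]; simp
  · simp

theorem gen_map {A B : Type*} [CommRing A] [CommRing B] (φ : A →+* B) {n : ℕ}
    (N : Matrix (Fin n) (Fin n) A) (R : Fin n → Fin n → Prop)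
    (a : (Fin n × Fin n) ⊕ (Fin n × Fin n)) : (gen N R a).map φ = gen (N.map φ) R a := by
  rcases a with p | p
  · simp only [gen]
    split_ifs
    · rw [adm_apply, adm_apply, Matrix.map_sub _ (fun a b => map_sub φ a b), Matrix.map_mul,
        Matrix.map_mul, Matrix.map_single]; simp
    · simp
  · simp only [gen]
    split_ifs
    · rw [Matrix.map_single]; simp
    · simp

theorem genM_map {A B : Type*} [CommRing A] [CommRing B] (φ : A →+* B) {n : ℕ}
    (N : Matrix (Fin n) (Fin n) A) (R : Fin n → Fin n → Prop) :
    (genM N R).map φ = genM (N.map φ) R := by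
  ext a p
  exact congrFun (congrFun (gen_map φ N R a) p.1) p.2

theorem rank_pow_eq {K : Type*} [Field K] {n : ℕ} (N : Matrix (Fin n) (Fin n) K) (j : ℕ) :
    (N ^ j).rank = Module.finrank K (LinearMap.range (N.mulVecLin ^ j)) := by
  have : (N ^ j).mulVecLin = N.mulVecLin ^ j := map_pow (Matrix.toLinAlgEquiv' (R := K)) N j
  rw [← this]; rfl

theorem nilp_lin {K : Type*} [Field K] {n : ℕ} (N : Matrix (Fin n) (Fin n) K)
    (h : IsNilpotent N) : IsNilpotent N.mulVecLin :=
  h.map (Matrix.toLinAlgEquiv' (R := K))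
end


section
open Matrix

theorem partI_rank {n : ℕ} (Rs Rr : Fin n → Fin n → Prop) (pos : Fin n → Fin n)
    (hs : ∀ i j, Rs i j → i < j) (hrs : ∀ i j, Rr i j → Rs i j)
    (hr : ∀ i j, Rr i j ↔ i < j ∧ pos i < pos j)
    (hrank : ∀ j, (((Nt Rs Rr).map (algebraMap (PolA n) (KK n))) ^ j).rank =
      (((Nt Rs Rr).map ((algebraMap (PolA n) (KK n)).comp (sp n))) ^ j).rank) :
    (genM ((Nt Rs Rr).map (algebraMap (PolA n) (KK n))) Rs).rank ≤
      (genM ((Nt Rs Rr).map ((algebraMap (PolA n) (KK n)).comp (sp n))) Rr).rank := by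
  classical
  set N1 := (Nt Rs Rr).map (algebraMap (PolA n) (KK n)) with hN1
  set N0 := (Nt Rs Rr).map ((algebraMap (PolA n) (KK n)).comp (sp n)) with hN0
  have hz : ∀ i j, ¬ Rs i j → Nt Rs Rr i j = 0 := by
    intro i j h
    have h' : ¬ Rr i j := fun h' => h (hrs i j h')
    simp [Nt, h, h']
  have hz0 : ∀ i j, ¬ Rr i j → N0 i j = 0 := by
    intro i j h
    simp only [hN0, Nt, Matrix.map_apply, Matrix.of_apply, if_neg h]
    split_ifs
    · simp [sp_none]
    · simp
  have hu1 : ∀ i j, j ≤ i → N1 i j = 0 := by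
    intro i j h
    rw [hN1, Matrix.map_apply, hz i j (fun h' => absurd (hs i j h') (not_lt.mpr h)), map_zero]
  have hu0 : ∀ i j, j ≤ i → N0 i j = 0 := by
    intro i j h
    exact hz0 i j (fun h' => absurd (hs i j (hrs i j h')) (not_lt.mpr h))
  have hc : Module.finrank (KK n) (centr N1.mulVecLin) =
      Module.finrank (KK n) (centr N0.mulVecLin) := by
    apply finrank_centr_congr (Module.finrank (KK n) (Fin n → KK n))
    · exact nilp_lin _ (strictUpper_nilp _ hu1)
    · exact nilp_lin _ (strictUpper_nilp _ hu0)
    · exact le_rfl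
    · intro j
      rw [← rank_pow_eq, ← rank_pow_eq, hrank j]
  have h1 := coiso N0 Rr pos hr hz0
  choose d hd using fun p : Fin n × Fin n => exists_der_ext (K := KK n) (pd (some p))
  have h2 := iso N1 Rs hs hu1 d
    (fun p q x => der_ext_comm _ _ (pd_comm (some p) (some q)) _ _ (hd p) (hd q) x)
    (fun p => algebraMap (PolA n) (KK n) (if Rr p.1 p.2 then 1 else MvPolynomial.X none))
    (by
      intro p _ h0
      have := (IsFractionRing.injective (PolA n) (KK n)) (h0.trans (map_zero _).symm)
      split_ifs at this
      · exact one_ne_zero this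
      · exact MvPolynomial.X_ne_zero _ this)
    (by
      intro p hp
      have h3 := pd_some_Nt Rs Rr hrs p hp
      ext i j
      have h4 := congrFun (congrFun h3 i) j
      rw [Matrix.map_apply] at h4
      rw [Matrix.map_apply, hN1, Matrix.map_apply, hd]
      refine (congrArg _ h4).trans ?_
      rw [Matrix.smul_apply, Matrix.smul_apply,
        smul_eq_mul, smul_eq_mul, map_mul, Matrix.single_apply, Matrix.single_apply]
      congr 1
      split_ifs <;> simp)
  omega

theorem exists_flow {n : ℕ} (Rs Rr : Fin n → Fin n → Prop) (pos : Fin n → Fin n)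
    (hs : ∀ i j, Rs i j → i < j) (hrs : ∀ i j, Rr i j → Rs i j)
    (hr : ∀ i j, Rr i j ↔ i < j ∧ pos i < pos j)
    (hrank : ∀ j, (((Nt Rs Rr).map (algebraMap (PolA n) (KK n))) ^ j).rank =
      (((Nt Rs Rr).map ((algebraMap (PolA n) (KK n)).comp (sp n))) ^ j).rank) :
    ∃ (D : Derivation ℤ (PolA n) (PolA n)) (Y : Matrix (Fin n) (Fin n) (PolA n)),
      (∀ i j, j < i → Y i j = 0) ∧ (Nt Rs Rr).map D = Y * Nt Rs Rr - Nt Rs Rr * Y ∧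
      ¬ (MvPolynomial.X none : PolA n) ∣ D (MvPolynomial.X none) := by
  classical
  have hle := partI_rank Rs Rr pos hs hrs hr hrank
  have hinr : ∀ p : Fin n × Fin n, Rs p.1 p.2 →
      (fun q : Fin n × Fin n => (Matrix.single p.1 p.2 (1 : KK n)) q.1 q.2) ∈
      Submodule.span (KK n)
        (Set.range (genM ((Nt Rs Rr).map (algebraMap (PolA n) (KK n))) Rs).row) := by
    intro p hp
    apply Submodule.subset_span
    refine ⟨Sum.inr p, ?_⟩
    funext q
    simp [genM, gen, hp, Matrix.row]
  obtain ⟨q, hq, c, hc⟩ := cramer_lattice (K := KK n) (sp n) (genM (Nt Rs Rr) Rr)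
    (fun p => pd none (Nt Rs Rr p.1 p.2))
    (Submodule.span (KK n)
      (Set.range (genM ((Nt Rs Rr).map (algebraMap (PolA n) (KK n))) Rs).row))
    (by
      intro a
      have e := fun p => congrFun (congrFun (genM_map (algebraMap (PolA n) (KK n)) (Nt Rs Rr) Rr) a) p
      simp only [Matrix.map_apply] at e
      simp only [e]
      rcases a with p | p
      · apply Submodule.subset_span
        exact ⟨Sum.inl p, rfl⟩
      · by_cases hp : Rr p.1 p.2
        · have := hinr p (hrs _ _ hp)
          convert this using 2
          simp [genM, gen, hp]
        · convert Submodule.zero_mem _ using 2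
          simp [genM, gen, hp])
    (by
      have e : (fun p : Fin n × Fin n => algebraMap (PolA n) (KK n) (pd none (Nt Rs Rr p.1 p.2))) =
        ∑ p : Fin n × Fin n, algebraMap (PolA n) (KK n) (pd none (Nt Rs Rr p.1 p.2)) •
          (fun q : Fin n × Fin n => (Matrix.single p.1 p.2 (1 : KK n)) q.1 q.2) := by
        funext p
        rw [Finset.sum_apply, Finset.sum_eq_single p]
        · simp
        · intro b _ hb
          rw [Pi.smul_apply, Matrix.single_apply, if_neg, smul_zero]
          rintro ⟨h1, h2⟩
          exact hb (Prod.ext h1 h2)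
        · simp
      rw [e]
      refine Submodule.sum_mem _ fun p _ => ?_
      by_cases hp : Rs p.1 p.2
      · exact Submodule.smul_mem _ _ (hinr p hp)
      · rw [pd_none_Nt]
        simp [hp])
    (by
      rw [← Matrix.rank_eq_finrank_span_row, genM_map]
      exact hle)
  refine ⟨q • pd none - ∑ p : Fin n × Fin n,
      (if Rr p.1 p.2 then c (Sum.inr p) else 0) • pd (some p),
    Matrix.of fun i j => if i ≤ j then c (Sum.inl (i, j)) else 0, ?_, ?_, ?_⟩
  · intro i j h
    simp [not_le.mpr h]
  · set Y : Matrix (Fin n) (Fin n) (PolA n) :=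
      Matrix.of fun i j => if i ≤ j then c (Sum.inl (i, j)) else 0 with hY
    have e1 : Y * Nt Rs Rr - Nt Rs Rr * Y = ∑ p : Fin n × Fin n,
        c (Sum.inl p) • gen (Nt Rs Rr) Rr (Sum.inl p) := by
      rw [← adm_apply]
      conv_lhs => rw [Matrix.matrix_eq_sum_single Y]
      rw [← Finset.sum_product', map_sum]
      refine Finset.sum_congr rfl fun p _ => ?_
      simp only [gen, hY, Matrix.of_apply]
      split_ifs with h
      · rw [← map_smul]; congr 1
        rw [Matrix.smul_single, smul_eq_mul, mul_one]
      · simp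
    rw [e1]
    ext1 i j
    have h1 := hc (i, j)
    rw [Fintype.sum_sum_type] at h1
    have coe : ∀ x : PolA n, (q • pd none - ∑ p : Fin n × Fin n,
      (if Rr p.1 p.2 then c (Sum.inr p) else 0) • pd (some p) : Derivation ℤ (PolA n) (PolA n)) x =
      q * pd none x - ∑ p : Fin n × Fin n,
        (if Rr p.1 p.2 then c (Sum.inr p) else 0) * pd (some p) x := by
      intro x
      rw [Derivation.sub_apply, Derivation.smul_apply, smul_eq_mul]
      congr 1
      rw [← Derivation.coeFnAddMonoidHom_apply, map_sum, Finset.sum_apply]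
      rfl
    rw [Matrix.map_apply, coe, h1, Matrix.sum_apply, add_sub_assoc]
    simp only [Matrix.smul_apply, smul_eq_mul]
    convert add_zero _ using 2
    rw [sub_eq_zero]
    refine Finset.sum_congr rfl fun p _ => ?_
    simp only [genM, gen, Matrix.of_apply]
    split_ifs with h
    · have h3 := congrFun (congrFun (pd_some_Nt Rs Rr hrs p (hrs _ _ h)) i) j
      rw [Matrix.map_apply] at h3
      rw [h3, if_pos h, one_smul]
    · simp
    rfl
  · have coe : ∀ x : PolA n, (q • pd none - ∑ p : Fin n × Fin n,
      (if Rr p.1 p.2 then c (Sum.inr p) else 0) • pd (some p) : Derivation ℤ (PolA n) (PolA n)) x =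
      q * pd none x - ∑ p : Fin n × Fin n,
        (if Rr p.1 p.2 then c (Sum.inr p) else 0) * pd (some p) x := by
      intro x
      rw [Derivation.sub_apply, Derivation.smul_apply, smul_eq_mul]
      congr 1
      rw [← Derivation.coeFnAddMonoidHom_apply, map_sum, Finset.sum_apply]
      rfl
    rw [coe, Finset.sum_eq_zero, sub_zero]
    · rw [pd_apply, MvPolynomial.pderiv_X_self, mul_one]
      rintro ⟨z, rfl⟩
      apply hq
      rw [map_mul, sp_none, zero_mul]
    · intro p _
      rw [pd_apply, MvPolynomial.pderiv_X_of_ne (by simp), mul_zero]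

theorem partI {n : ℕ} (Rs Rr : Fin n → Fin n → Prop) (pos : Fin n → Fin n)
    (hs : ∀ i j, Rs i j → i < j) (hrs : ∀ i j, Rr i j → Rs i j)
    (hr : ∀ i j, Rr i j ↔ i < j ∧ pos i < pos j)
    (hrank : ∀ j, (((Nt Rs Rr).map (algebraMap (PolA n) (KK n))) ^ j).rank =
      (((Nt Rs Rr).map ((algebraMap (PolA n) (KK n)).comp (sp n))) ^ j).rank) (k j : ℕ) :
    (((Nt Rs Rr).map (algebraMap (PolA n) (KK n))) ^ j * Pm (KK n) n k).rank ≤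
      (((Nt Rs Rr).map ((algebraMap (PolA n) (KK n)).comp (sp n))) ^ j * Pm (KK n) n k).rank := by
  obtain ⟨D, Y, hY, hD, ht⟩ := exists_flow Rs Rr pos hs hrs hr hrank
  rw [← powP_map, ← powP_map]
  set W := Nt Rs Rr ^ j * Pm (PolA n) n k with hW
  have hDW := der_powP D _ Y hD hY j k
  by_contra hlt
  rw [not_le, ← Nat.succ_le_iff, le_rank_iff_minor] at hlt
  obtain ⟨f, g, hfg⟩ := hlt
  apply hfg
  have key := minors_vanish D W Y _ hDW (MvPolynomial.X none) MvPolynomial.X_prime ht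
    ((W.map ((algebraMap (PolA n) (KK n)).comp (sp n))).rank + 1) (by
      intro f g
      apply dvd_of_sp
      by_contra h0
      have : ((W.map ((algebraMap (PolA n) (KK n)).comp (sp n))).rank + 1) ≤
        (W.map ((algebraMap (PolA n) (KK n)).comp (sp n))).rank := by
        rw [le_rank_iff_minor]
        refine ⟨f, g, fun h1 => h0 ?_⟩
        rw [Matrix.submatrix_map] at h1
        have h2 := RingHom.map_det ((algebraMap (PolA n) (KK n)).comp (sp n)) (W.submatrix f g)
        rw [RingHom.mapMatrix_apply, h1] at h2
        exact (IsFractionRing.injective (PolA n) (KK n)) (h2.trans (map_zero _).symm)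
      omega)
    f g
  rw [Matrix.submatrix_map]
  have h2 := RingHom.map_det (algebraMap (PolA n) (KK n)) (W.submatrix f g)
  rw [RingHom.mapMatrix_apply, key, map_zero] at h2
  exact h2.symm
end


section
open Matrix

/-- uniform bound on the ranks of `N ^ j * Pm k` for `N` supported in `R` -/
def Bd {n : ℕ} (R : Fin n → Fin n → Prop) (k j c : ℕ) : Prop :=
  ∀ N : Matrix (Fin n) (Fin n) ℚ, (∀ a b, ¬ R a b → N a b = 0) → (N ^ j * Pm ℚ n k).rank ≤ c

theorem Bd.mono {n : ℕ} {R R' : Fin n → Fin n → Prop} (h : ∀ a b, R' a b → R a b) {k j c : ℕ}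
    (hB : Bd R k j c) : Bd R' k j c :=
  fun N hN => hB N fun a b hab => hN a b fun h' => hab (h a b h')

theorem rank_conj {n : ℕ} (U V N : Matrix (Fin n) (Fin n) ℚ) (hVU : V * U = 1)
    (hU : ∀ i j, j < i → U i j = 0) (j k : ℕ) :
    (N ^ j * Pm ℚ n k).rank ≤ ((U * N * V) ^ j * Pm ℚ n k).rank := by
  have hUV : U * V = 1 := mul_eq_one_comm.mp hVU
  have hp : ∀ j, (U * N * V) ^ j = U * N ^ j * V := by
    intro j
    induction j with
    | zero => simp [hUV]
    | succ j ih =>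
      rw [pow_succ, ih, pow_succ]
      calc U * N ^ j * V * (U * N * V) = U * N ^ j * (V * U) * N * V := by noncomm_ring
        _ = U * (N ^ j * N) * V := by rw [hVU]; noncomm_ring
  have e : N ^ j * Pm ℚ n k = V * ((U * N * V) ^ j * Pm ℚ n k) * (U * Pm ℚ n k) := by
    rw [hp, Matrix.mul_assoc V, Matrix.mul_assoc _ (Pm ℚ n k), upper_Pm U hU]
    calc N ^ j * Pm ℚ n k = (V * U) * N ^ j * ((V * U) * Pm ℚ n k) := by rw [hVU]; simp
      _ = _ := by noncomm_ring
  rw [e]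
  exact (Matrix.rank_mul_le_left _ _).trans (Matrix.rank_mul_le_right _ _)

theorem rank_perturb {n : ℕ} (N E : Matrix (Fin n) (Fin n) ℚ) (j k c : ℕ)
    (h : ∀ s : ℚ, s ≠ 0 → ((N + s • E) ^ j * Pm ℚ n k).rank ≤ c) :
    (N ^ j * Pm ℚ n k).rank ≤ c := by
  by_contra hlt
  have h1 := (le_rank_iff_minor (N ^ j * Pm ℚ n k) (c + 1)).mp (by omega)
  obtain ⟨f, g, hfg⟩ := h1
  set M : Matrix (Fin n) (Fin n) (Polynomial ℚ) :=
    (N.map Polynomial.C + (Polynomial.X : Polynomial ℚ) • E.map Polynomial.C) with hM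
  have hev : ∀ s : ℚ, M.map (Polynomial.evalRingHom s) = N + s • E := by
    intro s
    ext a b
    simp [hM]
    ring
  set P := ((M ^ j * Pm _ n k).submatrix f g).det with hP
  have hPe : ∀ s : ℚ, P.eval s = (((N + s • E) ^ j * Pm ℚ n k).submatrix f g).det := by
    intro s
    have := RingHom.map_det (Polynomial.evalRingHom s) ((M ^ j * Pm _ n k).submatrix f g)
    rw [RingHom.mapMatrix_apply, ← Matrix.submatrix_map, powP_map, hev] at this
    exact this
  have hP0 : P ≠ 0 := by
    intro h0
    have := hPe 0
    rw [h0] at this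
    simp at this
    exact hfg this.symm
  have hXP : Polynomial.X * P ≠ 0 := mul_ne_zero Polynomial.X_ne_zero hP0
  have : ∃ s : ℚ, (Polynomial.X * P).eval s ≠ 0 := by
    by_contra hall
    push Not at hall
    exact hXP (Polynomial.funext fun s => by rw [hall s]; simp)
  obtain ⟨s, hs⟩ := this
  rw [Polynomial.eval_mul, Polynomial.eval_X, hPe] at hs
  have h2 := (le_rank_iff_minor ((N + s • E) ^ j * Pm ℚ n k) (c + 1)).mpr
    ⟨f, g, right_ne_zero_of_mul hs⟩
  have h3 := h s (left_ne_zero_of_mul hs)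
  omega

theorem conj_entry {n : ℕ} (N : Matrix (Fin n) (Fin n) ℚ) (a b i j : Fin n) (c : ℚ)
    (hba : N b a = 0) :
    ((1 + single a b c) * N * (1 - single a b c)) i j =
      N i j + (if i = a then c * N b j else 0) - (if j = b then N i a * c else 0) := by
  have e : (1 + single a b c) * N * (1 - single a b c) =
    N + single a b c * N - N * single a b c - single a b c * N * single a b c := by noncomm_ring
  rw [e, Matrix.single_mul_mul_single, hba]
  simp only [Matrix.sub_apply, Matrix.add_apply, mul_zero, zero_mul, Matrix.single_zero,
    Matrix.zero_apply, sub_zero]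
  congr 1
  · congr 1
    split_ifs with h
    · subst h; simp
    · rw [Matrix.single_mul_apply_of_ne _ _ _ _ _ h]
  · split_ifs with h
    · subst h; simp
    · rw [Matrix.mul_single_apply_of_ne _ _ _ _ _ h]

theorem conjE_inv {n : ℕ} (a b : Fin n) (c : ℚ) (hab : a < b) :
    (1 - single a b c) * (1 + single a b c) = (1 : Matrix (Fin n) (Fin n) ℚ) := by
  have e : (1 - single a b c) * (1 + single a b c) = 
    1 - single a b c * (single a b c : Matrix (Fin n) (Fin n) ℚ) := by noncomm_ring
  rw [e, Matrix.single_mul_single_of_ne _ _ _ _ hab.ne', sub_zero]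

theorem conj_upper {n : ℕ} (a b : Fin n) (c : ℚ) (hab : a < b) (i j : Fin n) (hij : j < i) :
    (1 + single a b c : Matrix (Fin n) (Fin n) ℚ) i j = 0 := by
  rw [Matrix.add_apply, Matrix.one_apply_ne hij.ne', Matrix.single_apply, if_neg, add_zero]
  rintro ⟨rfl, rfl⟩
  exact absurd hab (not_lt.mpr hij.le)

theorem Bd_reduce {n : ℕ} (R : Fin n → Fin n → Prop) (x y : Fin n) (k j c : ℕ) (hxy : R x y)
    (h : ∀ N : Matrix (Fin n) (Fin n) ℚ, (∀ a b, ¬ R a b → N a b = 0) → N x y ≠ 0 →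
      (N ^ j * Pm ℚ n k).rank ≤ c) : Bd R k j c := by
  intro N hN
  by_cases h0 : N x y = 0
  · apply rank_perturb N (single x y 1)
    intro s hs
    apply h
    · intro a b hab
      rw [Matrix.add_apply, hN a b hab, Matrix.smul_apply, Matrix.single_apply, if_neg]
      · simp
      · rintro ⟨rfl, rfl⟩; exact hab hxy
    · simp [h0, hs]
  · exact h N hN h0

theorem Bd_moveA {n : ℕ} (R R' : Fin n → Fin n → Prop) (x y z : Fin n) (hxy : x < y) (hyz : y < z)
    (k j c : ℕ) (hB : Bd R' k j c) (hR : ∀ a b, R a b → a < b)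
    (hRxy : R x y) (hRR : ∀ a b, R a b → R' a b ∨ (a = x ∧ b = z))
    (h1 : ∀ i, R i y → i ≠ x → R' i z) (h2 : ∀ j, R z j → R' y j) :
    Bd R k j c := by
  apply Bd_reduce R x y k j c hRxy
  intro N hN h0
  have hzy : N z y = 0 := hN z y fun h => absurd (hR _ _ h) (not_lt.mpr hyz.le)
  refine (rank_conj (1 + single y z (N x z / N x y)) (1 - single y z (N x z / N x y)) N
    (conjE_inv y z _ hyz) (conj_upper y z _ hyz) j k).trans (hB _ ?_)
  intro a b hab
  rw [conj_entry _ _ _ _ _ _ hzy]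
  by_cases hxz : a = x ∧ b = z
  · obtain ⟨rfl, rfl⟩ := hxz
    rw [if_neg hxy.ne, if_pos rfl]
    field_simp
    ring
  · have h3 : N a b = 0 := hN a b fun h => (hRR a b h).elim hab hxz
    rw [h3]
    have h4 : (if a = y then N x z / N x y * N z b else 0) = 0 := by
      split_ifs with h
      · subst h
        rw [hN z b fun h => hab (h2 b h), mul_zero]
      · rfl
    have h5 : (if b = z then N a y * (N x z / N x y) else 0) = 0 := by
      split_ifs with h
      · subst h
        rw [hN a y fun h => hab (h1 a h fun h6 => hxz ⟨h6, rfl⟩), zero_mul]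
      · rfl
    rw [h4, h5]; simp

theorem Bd_moveB {n : ℕ} (R R' : Fin n → Fin n → Prop) (x y z : Fin n) (hxy : x < y) (hyz : y < z)
    (k j c : ℕ) (hB : Bd R' k j c) (hR : ∀ a b, R a b → a < b)
    (hRyz : R y z) (hRR : ∀ a b, R a b → R' a b ∨ (a = x ∧ b = z))
    (h1 : ∀ j, R y j → j ≠ z → R' x j) (h2 : ∀ i, R i x → R' i y) :
    Bd R k j c := by
  apply Bd_reduce R y z k j c hRyz
  intro N hN h0
  have hyx : N y x = 0 := hN y x fun h => absurd (hR _ _ h) (not_lt.mpr hxy.le)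
  refine (rank_conj (1 + single x y (-(N x z / N y z))) (1 - single x y (-(N x z / N y z))) N
    (conjE_inv x y _ hxy) (conj_upper x y _ hxy) j k).trans (hB _ ?_)
  intro a b hab
  rw [conj_entry _ _ _ _ _ _ hyx]
  by_cases hxz : a = x ∧ b = z
  · obtain ⟨rfl, rfl⟩ := hxz
    rw [if_pos rfl, if_neg hyz.ne']
    field_simp
    ring
  · have h3 : N a b = 0 := hN a b fun h => (hRR a b h).elim hab hxz
    rw [h3]
    have h4 : (if a = x then -(N x z / N y z) * N y b else 0) = 0 := by
      split_ifs with h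
      · subst h
        rw [hN y b fun h => hab (h1 b h fun h6 => hxz ⟨rfl, h6⟩), mul_zero]
      · rfl
    have h5 : (if b = y then N a x * -(N x z / N y z) else 0) = 0 := by
      split_ifs with h
      · subst h
        rw [hN a x fun h => hab (h2 a h), zero_mul]
      · rfl
    rw [h4, h5]; simp

theorem pow_supp {n : ℕ} (N : Matrix (Fin n) (Fin n) ℚ) (col : Fin n → ℕ)
    (h : ∀ i j, N i j ≠ 0 → col i < col j) (m : ℕ) (i j : Fin n) (h0 : (N ^ m) i j ≠ 0) :
    col i + m ≤ col j := by
  induction m generalizing j with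
  | zero =>
    rw [pow_zero] at h0
    by_cases hij : i = j
    · subst hij; simp
    · exact absurd (Matrix.one_apply_ne hij) h0
  | succ m ih =>
    rw [pow_succ, Matrix.mul_apply] at h0
    obtain ⟨l, _, hl⟩ := Finset.exists_ne_zero_of_sum_ne_zero h0
    have h1 := ih l (left_ne_zero_of_mul hl)
    have h2 := h l j (right_ne_zero_of_mul hl)
    omega

theorem rank_upper {n : ℕ} (N : Matrix (Fin n) (Fin n) ℚ) (col : Fin n → ℕ)
    (h : ∀ i j, N i j ≠ 0 → col i < col j) (m k : ℕ) :
    (N ^ m * Pm ℚ n k).rank ≤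
      (Finset.univ.filter fun v : Fin n => (v : ℕ) < k ∧ m ≤ col v).card := by
  classical
  have e : N ^ m * Pm ℚ n k = (N ^ m * Pm ℚ n k) *
      Matrix.diagonal (fun v : Fin n => if (v : ℕ) < k ∧ m ≤ col v then (1 : ℚ) else 0) := by
    ext i j
    rw [Matrix.mul_diagonal, Pm, Matrix.mul_diagonal]
    by_cases h1 : (j : ℕ) < k
    · by_cases h2 : m ≤ col j
      · simp [h1, h2]
      · have : (N ^ m) i j = 0 := by
          by_contra h0
          have := pow_supp N col h m i j h0
          omega
        simp [this]
    · simp [h1]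
  rw [e]
  refine (Matrix.rank_mul_le_right _ _).trans ?_
  rw [Matrix.rank_diagonal, Fintype.card_subtype]
  apply le_of_eq
  congr 1
  ext v
  simp

theorem rank_lower {n : ℕ} (col : Fin n → ℕ) (prev : Fin n → Fin n)
    (h1 : ∀ v, 0 < col v → col (prev v) + 1 = col v)
    (h2 : ∀ v w, 0 < col v → 0 < col w → prev v = prev w → v = w) (m k : ℕ) :
    (Finset.univ.filter fun v : Fin n => (v : ℕ) < k ∧ m ≤ col v).card ≤
    ((Matrix.of fun i j => if 0 < col j ∧ i = prev j then (1 : ℚ) else 0) ^ m * Pm ℚ n k).rank := by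
  classical
  set N : Matrix (Fin n) (Fin n) ℚ :=
    Matrix.of fun i j => if 0 < col j ∧ i = prev j then (1 : ℚ) else 0 with hN
  have hcol : ∀ m v, m ≤ col v → col (prev^[m] v) + m = col v := by
    intro m
    induction m with
    | zero => intro v _; simp
    | succ m ih =>
      intro v hv
      rw [Function.iterate_succ_apply]
      have := h1 v (by omega)
      have := ih (prev v) (by omega)
      omega
  have hinj : ∀ m v w, m ≤ col v → m ≤ col w → prev^[m] v = prev^[m] w → v = w := by
    intro m
    induction m with
    | zero => intro v w _ _ h; simpa using h
    | succ m ih =>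
      intro v w hv hw h
      rw [Function.iterate_succ_apply, Function.iterate_succ_apply] at h
      have e1 := h1 v (by omega)
      have e2 := h1 w (by omega)
      exact h2 v w (by omega) (by omega) (ih _ _ (by omega) (by omega) h)
  have hpow : ∀ m v, m ≤ col v → ∀ i, (N ^ m) i v = if i = prev^[m] v then 1 else 0 := by
    intro m
    induction m with
    | zero =>
      intro v _ i
      rw [pow_zero, Matrix.one_apply, Function.iterate_zero, id]
    | succ m ih =>
      intro v hv i
      rw [pow_succ, Matrix.mul_apply, Finset.sum_eq_single (prev v)]
      · have := h1 v (by omega)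
        rw [ih (prev v) (by omega), Function.iterate_succ_apply]
        simp [hN, show 0 < col v by omega]
      · intro b _ hb
        simp [hN, hb]
      · simp
  rw [le_rank_iff_minor]
  set S := Finset.univ.filter fun v : Fin n => (v : ℕ) < k ∧ m ≤ col v with hS
  have hmem : ∀ a : Fin S.card, ((S.equivFin.symm a : Fin n) : ℕ) < k ∧
      m ≤ col (S.equivFin.symm a : Fin n) := by
    intro a
    have := (S.equivFin.symm a).2
    exact (Finset.mem_filter.mp this).2
  refine ⟨fun a => prev^[m] (S.equivFin.symm a), fun a => S.equivFin.symm a, ?_⟩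
  have : (N ^ m * Pm ℚ n k).submatrix (fun a => prev^[m] (S.equivFin.symm a))
      (fun a : Fin S.card => (S.equivFin.symm a : Fin n)) = 1 := by
    ext a b
    rw [Matrix.submatrix_apply, Pm, Matrix.mul_diagonal, if_pos (hmem b).1, mul_one,
      hpow m _ (hmem b).2, Matrix.one_apply]
    by_cases hab : a = b
    · simp [hab]
    · rw [if_neg, if_neg hab]
      intro h
      have := hinj m _ _ (hmem a).2 (hmem b).2 h
      exact hab (S.equivFin.symm.injective (Subtype.ext this))
  rw [this]
  simp
end


section
/-- `a` occurs before `b` in the word -/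
def pre (a b : ℕ) : List ℕ → Prop
  | [] => False
  | c :: l => (a = c ∧ b ∈ l) ∨ pre a b l

theorem pre_append (a b : ℕ) (u v : List ℕ) :
    pre a b (u ++ v) ↔ pre a b u ∨ pre a b v ∨ (a ∈ u ∧ b ∈ v) := by
  induction u with
  | nil => simp [pre]
  | cons c u ih =>
    simp only [List.cons_append, pre, ih, List.mem_append, List.mem_cons]
    tauto

theorem pre_mem {a b : ℕ} {l : List ℕ} (h : pre a b l) : a ∈ l ∧ b ∈ l := by
  induction l with
  | nil => exact h.elim
  | cons c l ih =>
    rcases h with ⟨h1, h2⟩ | h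
    · exact ⟨by simp [h1], by simp [h2]⟩
    · exact ⟨by simp [ih h], by simp [ih h]⟩

theorem pre_iff (a b : ℕ) (l : List ℕ) :
    pre a b l ↔ ∃ i j : ℕ, i < j ∧ l[i]? = some a ∧ l[j]? = some b := by
  induction l with
  | nil => simp [pre]
  | cons c l ih =>
    rw [pre, ih]
    constructor
    · rintro (⟨rfl, h⟩ | ⟨i, j, hij, h1, h2⟩)
      · obtain ⟨j, hj⟩ := List.mem_iff_getElem?.mp h
        exact ⟨0, j + 1, by omega, by simp, by simpa using hj⟩
      · exact ⟨i + 1, j + 1, by omega, by simpa using h1, by simpa using h2⟩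
    · rintro ⟨i, j, hij, h1, h2⟩
      obtain ⟨j, rfl⟩ : ∃ j', j = j' + 1 := ⟨j - 1, by omega⟩
      rw [List.getElem?_cons_succ] at h2
      rcases i with _ | i
      · left
        rw [List.getElem?_cons_zero] at h1
        exact ⟨(Option.some.inj h1).symm, List.mem_of_getElem? h2⟩
      · right
        rw [List.getElem?_cons_succ] at h1
        exact ⟨i, j, by omega, h1, h2⟩

/-- support relation attached to a word -/
def Rw (n : ℕ) (w : List ℕ) (a b : Fin n) : Prop := a < b ∧ pre a b w

/-- elementary Knuth moves -/
inductive KStep : List ℕ → List ℕ → Prop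
  | a (u v : List ℕ) (x y z : ℕ) : x < y → y < z →
      KStep (u ++ x :: z :: y :: v) (u ++ z :: x :: y :: v)
  | b (u v : List ℕ) (x y z : ℕ) : x < y → y < z →
      KStep (u ++ y :: x :: z :: v) (u ++ y :: z :: x :: v)

/-- Knuth equivalence -/
def KEq : List ℕ → List ℕ → Prop := Relation.EqvGen KStep

theorem KEq.refl' (w : List ℕ) : KEq w w := Relation.EqvGen.refl w

theorem KEq.symm' {w w' : List ℕ} (h : KEq w w') : KEq w' w := Relation.EqvGen.symm _ _ h

theorem KEq.trans' {w w' w'' : List ℕ} (h : KEq w w') (h' : KEq w' w'') : KEq w w'' :=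
  Relation.EqvGen.trans _ _ _ h h'

theorem KEq.app {w w' : List ℕ} (h : KEq w w') (p s : List ℕ) : KEq (p ++ w ++ s) (p ++ w' ++ s) := by
  induction h with
  | rel w w' h =>
    apply Relation.EqvGen.rel
    rcases h with ⟨u, v, x, y, z, h1, h2⟩ | ⟨u, v, x, y, z, h1, h2⟩
    · have := KStep.a (p ++ u) (v ++ s) x y z h1 h2
      simpa using this
    · have := KStep.b (p ++ u) (v ++ s) x y z h1 h2
      simpa using this
  | refl w => exact KEq.refl' _
  | symm _ _ _ ih => exact ih.symm'
  | trans _ _ _ _ _ ih1 ih2 => exact ih1.trans' ih2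

theorem KEq.cons {w w' : List ℕ} (h : KEq w w') (a : ℕ) : KEq (a :: w) (a :: w') := by
  have := h.app [a] []
  simpa using this

theorem KStep.perm {w w' : List ℕ} (h : KStep w w') : w.Perm w' := by
  rcases h with ⟨u, v, x, y, z, h1, h2⟩ | ⟨u, v, x, y, z, h1, h2⟩
  · exact List.Perm.append_left _ (List.Perm.swap _ _ _)
  · exact List.Perm.append_left _ (List.Perm.cons _ (List.Perm.swap _ _ _))

theorem KEq.perm {w w' : List ℕ} (h : KEq w w') : w.Perm w' := by
  induction h with
  | rel _ _ h => exact h.perm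
  | refl w => exact List.Perm.refl _
  | symm _ _ _ ih => exact ih.symm
  | trans _ _ _ _ _ ih1 ih2 => exact ih1.trans ih2

theorem KStep_Bd {n : ℕ} {w w' : List ℕ} (h : KStep w w') (hnd : w.Nodup) (hn : ∀ a ∈ w, a < n)
    (k j c : ℕ) : Bd (Rw n w) k j c ↔ Bd (Rw n w') k j c := by
  rcases h with ⟨u, v, x, y, z, h1, h2⟩ | ⟨u, v, x, y, z, h1, h2⟩
  · have hx : x < n := hn x (by simp)
    have hy : y < n := hn y (by simp)
    have hz : z < n := hn z (by simp)
    have hnd1 := hnd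
    simp only [List.nodup_append, List.nodup_cons, List.mem_cons, not_or] at hnd1
    constructor
    · apply Bd.mono
      rintro a b ⟨hab, h⟩
      rw [Fin.lt_def] at hab
      refine ⟨hab, ?_⟩
      simp only [pre_append, pre, List.mem_cons] at h ⊢
      grind
    · intro hB
      apply Bd_moveA _ (Rw n (u ++ z :: x :: y :: v)) ⟨x, hx⟩ ⟨y, hy⟩ ⟨z, hz⟩ h1 h2 k j c hB
      · intro a b h; exact h.1
      · refine ⟨h1, ?_⟩
        simp [pre_append, pre]
      · rintro a b ⟨hab, h⟩
        by_cases hc : a = ⟨x, hx⟩ ∧ b = ⟨z, hz⟩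
        · exact Or.inr hc
        · left
          rw [Fin.ext_iff, Fin.ext_iff] at hc
          refine ⟨hab, ?_⟩
          simp only [pre_append, pre, List.mem_cons] at h hc ⊢
          grind
      · rintro a ⟨hab, h⟩ hne
        have hne' : (a : ℕ) ≠ x := fun h => hne (Fin.ext h)
        rw [Fin.lt_def] at hab
        simp only at hab
        refine ⟨hab.trans h2, ?_⟩
        have hv : y ∈ v → False := by grind
        have hp := @pre_mem a y v
        have hp := @pre_mem a y u
        simp only [pre_append, pre, List.mem_cons] at h ⊢
        grind
      · rintro b ⟨hab, h⟩
        rw [Fin.lt_def] at hab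
        simp only at hab
        refine ⟨h2.trans hab, ?_⟩
        have hp := @pre_mem z b v
        have hp := @pre_mem z b u
        simp only [pre_append, pre, List.mem_cons] at h ⊢
        grind
  · have hx : x < n := hn x (by simp)
    have hy : y < n := hn y (by simp)
    have hz : z < n := hn z (by simp)
    have hnd1 := hnd
    simp only [List.nodup_append, List.nodup_cons, List.mem_cons, not_or] at hnd1
    constructor
    · apply Bd.mono
      rintro a b ⟨hab, h⟩
      rw [Fin.lt_def] at hab
      refine ⟨hab, ?_⟩
      simp only [pre_append, pre, List.mem_cons] at h ⊢
      grind
    · intro hB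
      apply Bd_moveB _ (Rw n (u ++ y :: z :: x :: v)) ⟨x, hx⟩ ⟨y, hy⟩ ⟨z, hz⟩ h1 h2 k j c hB
      · intro a b h; exact h.1
      · refine ⟨h2, ?_⟩
        simp [pre_append, pre]
      · rintro a b ⟨hab, h⟩
        by_cases hc : a = ⟨x, hx⟩ ∧ b = ⟨z, hz⟩
        · exact Or.inr hc
        · left
          rw [Fin.ext_iff, Fin.ext_iff] at hc
          refine ⟨hab, ?_⟩
          simp only [pre_append, pre, List.mem_cons] at h hc ⊢
          grind
      · rintro b ⟨hab, h⟩ hne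
        have hne' : (b : ℕ) ≠ z := fun h => hne (Fin.ext h)
        rw [Fin.lt_def] at hab
        simp only at hab
        refine ⟨h1.trans hab, ?_⟩
        have hp := @pre_mem y b v
        have hp := @pre_mem y b u
        simp only [pre_append, pre, List.mem_cons] at h ⊢
        grind
      · rintro a ⟨hab, h⟩
        rw [Fin.lt_def] at hab
        simp only at hab
        refine ⟨hab.trans h1, ?_⟩
        have hp := @pre_mem a x v
        have hp := @pre_mem a x u
        simp only [pre_append, pre, List.mem_cons] at h ⊢
        grind

theorem KEq_Bd {n : ℕ} {w w' : List ℕ} (h : KEq w w') (hnd : w.Nodup) (hn : ∀ a ∈ w, a < n)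
    (k j c : ℕ) : Bd (Rw n w) k j c ↔ Bd (Rw n w') k j c := by
  induction h with
  | rel _ _ h => exact KStep_Bd h hnd hn k j c
  | refl w => exact Iff.rfl
  | symm w w' h ih =>
    have hp := KEq.perm h
    exact (ih (hp.nodup_iff.mpr hnd) (fun a ha => hn a (hp.mem_iff.mp ha))).symm
  | trans w w' w'' h h' ih1 ih2 =>
    have hp := KEq.perm h
    exact (ih1 hnd hn).trans
      (ih2 (hp.nodup_iff.mp hnd) (fun a ha => hn a (hp.mem_iff.mpr ha)))
end


section
/-- row reading word, bottom row first -/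
def rd : List (List ℕ) → List ℕ
  | [] => []
  | r :: T => rd T ++ r

theorem move_left (l : List ℕ) (a x : ℕ) (hx : x < a) (hs : (a :: l).Pairwise (· < ·)) :
    KEq (a :: (l ++ [x])) (a :: x :: l) := by
  induction l generalizing a with
  | nil => exact KEq.refl' _
  | cons b l ih =>
    have hab : a < b := (List.pairwise_cons.mp hs).1 b (by simp)
    have h1 := ih b (hx.trans hab) (List.pairwise_cons.mp hs).2
    refine (KEq.cons h1 a).trans' (KEq.symm' (Relation.EqvGen.rel _ _ ?_))
    exact KStep.b [] l x a b hx hab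

theorem insRow_none (x : ℕ) (r r' : List ℕ) (h : insRow x r = (r', none)) : r' = r ++ [x] := by
  induction r generalizing r' with
  | nil => simp [insRow] at h; simp [h]
  | cons a r ih =>
    rw [insRow] at h
    split_ifs at h with hc
    · simp only [Prod.mk.injEq] at h
      rw [← h.1, ih (insRow x r).1 (Prod.ext rfl h.2)]
      rfl
    · simp at h

theorem insRow_none_le (x : ℕ) (r r' : List ℕ) (h : insRow x r = (r', none)) : ∀ a ∈ r, a ≤ x := by
  induction r generalizing r' with
  | nil => simp
  | cons a r ih =>
    rw [insRow] at h
    split_ifs at h with hc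
    · simp only [Prod.mk.injEq] at h
      intro b hb
      rcases List.mem_cons.mp hb with rfl | hb
      · exact hc
      · exact ih _ (Prod.ext rfl h.2) b hb
    · simp at h

theorem insRow_some (x y : ℕ) (r r' : List ℕ) (h : insRow x r = (r', some y)) :
    ∃ L D, r = L ++ y :: D ∧ r' = L ++ x :: D ∧ (∀ a ∈ L, a ≤ x) ∧ x < y := by
  induction r generalizing r' with
  | nil => simp [insRow] at h
  | cons a r ih =>
    rw [insRow] at h
    split_ifs at h with hc
    · simp only [Prod.mk.injEq] at h
      obtain ⟨L, D, h1, h2, h3, h4⟩ := ih (insRow x r).1 (Prod.ext rfl h.2)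
      refine ⟨a :: L, D, by simp [h1], by rw [← h.1, h2]; rfl, ?_, h4⟩
      intro b hb
      rcases List.mem_cons.mp hb with rfl | hb
      · exact hc
      · exact h3 b hb
    · simp only [Prod.mk.injEq, Option.some.injEq] at h
      exact ⟨[], r, by simp [h.2], by simp [h.1], by simp, by omega⟩

theorem move_y (L D : List ℕ) (x y : ℕ) (hxy : x < y) (hL : ∀ a ∈ L, a < x)
    (hs : L.Pairwise (· < ·)) : KEq (L ++ y :: x :: D) (y :: (L ++ x :: D)) := by
  induction L with
  | nil => exact KEq.refl' _
  | cons a L ih =>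
    have h1 := ih (fun b hb => hL b (by simp [hb])) (List.pairwise_cons.mp hs).2
    refine (KEq.cons h1 a).trans' (Relation.EqvGen.rel _ _ ?_)
    rcases L with _ | ⟨b, L⟩
    · exact KStep.a [] D a x y (hL a (by simp)) hxy
    · have hab : a < b := (List.pairwise_cons.mp hs).1 b (by simp)
      have hb : b < x := hL b (by simp)
      exact KStep.a [] (L ++ x :: D) a b y hab (hb.trans hxy)

theorem row_knuth (x y : ℕ) (r r' : List ℕ) (hs : r.Pairwise (· < ·)) (hx : x ∉ r)
    (h : insRow x r = (r', some y)) : KEq (r ++ [x]) (y :: r') := by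
  obtain ⟨L, D, rfl, rfl, h3, h4⟩ := insRow_some x y r r' h
  rw [List.pairwise_append] at hs
  have h5 := move_left D y x h4 hs.2.1
  have h6 := h5.app L []
  have h7 := move_y L D x y h4 (fun a ha => lt_of_le_of_ne (h3 a ha)
    (fun h => hx (by rw [← h]; simp [ha]))) hs.1
  refine KEq.trans' ?_ h7
  simpa using h6

/-- column strictness between rows -/
def dom (r r' : List ℕ) : Prop := ∀ (i b : ℕ), r'[i]? = some b → ∃ a, r[i]? = some a ∧ a < b

theorem dom_nil (r : List ℕ) : dom r [] := by intro i b h; simp at h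

theorem dom_cons (a b : ℕ) (r r' : List ℕ) : dom (a :: r) (b :: r') ↔ a < b ∧ dom r r' := by
  constructor
  · intro h
    constructor
    · obtain ⟨c, hc, hlt⟩ := h 0 b (by simp)
      simp at hc; omega
    · intro i c hc
      obtain ⟨d, hd, hlt⟩ := h (i + 1) c (by simpa using hc)
      exact ⟨d, by simpa using hd, hlt⟩
  · rintro ⟨h1, h2⟩ i c hc
    rcases i with _ | i
    · simp at hc; exact ⟨a, by simp, by omega⟩
    · obtain ⟨d, hd, hlt⟩ := h2 i c (by simpa using hc)
      exact ⟨d, by simpa using hd, hlt⟩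

theorem not_dom_nil (b : ℕ) (r' : List ℕ) : ¬ dom [] (b :: r') := by
  intro h
  obtain ⟨c, hc, _⟩ := h 0 b (by simp)
  simp at hc

theorem dom_trans {r s t : List ℕ} (h1 : dom r s) (h2 : dom s t) : dom r t := by
  intro i c hc
  obtain ⟨b, hb, hbc⟩ := h2 i c hc
  obtain ⟨a, ha, hab⟩ := h1 i b hb
  exact ⟨a, ha, hab.trans hbc⟩

instance : IsTrans (List ℕ) dom := ⟨fun _ _ _ => dom_trans⟩

theorem dom_length {r s : List ℕ} (h : dom r s) : s.length ≤ r.length := by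
  by_contra hlt
  push Not at hlt
  obtain ⟨a, ha, _⟩ := h r.length s[r.length] (by simp [hlt])
  simp at ha

theorem dom_append {r s : List ℕ} (h : dom r s) (t : List ℕ) : dom (r ++ t) s := by
  intro i b hb
  obtain ⟨a, ha, hlt⟩ := h i b hb
  have hi : i < r.length := by
    by_contra hge
    rw [List.getElem?_eq_none (by omega)] at ha
    simp at ha
  exact ⟨a, by rw [List.getElem?_append_left hi, ha], hlt⟩

theorem dom_ins {x y : ℕ} {r r1 s : List ℕ} (h : insRow x r = (r1, some y)) (hd : dom r s) :
    dom r1 s := by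
  obtain ⟨L, D, rfl, rfl, -, h4⟩ := insRow_some x y r r1 h
  clear h
  induction L generalizing s with
  | nil =>
    rcases s with _ | ⟨b, s⟩
    · exact dom_nil _
    · simp only [List.nil_append, dom_cons] at hd ⊢
      exact ⟨h4.trans hd.1, hd.2⟩
  | cons a L ih =>
    rcases s with _ | ⟨b, s⟩
    · exact dom_nil _
    · simp only [List.cons_append, dom_cons] at hd ⊢
      exact ⟨hd.1, ih hd.2⟩

theorem dom_ins_ins {x y : ℕ} {r r1 s : List ℕ} (h : insRow x r = (r1, some y)) (hd : dom r s) :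
    dom r1 (insRow y s).1 := by
  induction r generalizing r1 s with
  | nil => simp [insRow] at h
  | cons a r ih =>
    have hfull := h
    rw [insRow] at h
    split_ifs at h with hc
    · simp only [Prod.mk.injEq] at h
      have h' : insRow x r = ((insRow x r).1, some y) := Prod.ext rfl h.2
      obtain ⟨_, _, _, _, _, hxy⟩ := insRow_some _ _ _ _ hfull
      rw [← h.1]
      rcases s with _ | ⟨b, s⟩
      · simp only [insRow, dom_cons]
        exact ⟨by omega, dom_nil _⟩
      · rw [dom_cons] at hd
        rw [insRow]
        split_ifs with hb
        · simp only [dom_cons]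
          exact ⟨hd.1, ih h' hd.2⟩
        · simp only [dom_cons]
          exact ⟨by omega, dom_ins h' hd.2⟩
    · simp only [Prod.mk.injEq, Option.some.injEq] at h
      obtain ⟨rfl, rfl⟩ := h
      rcases s with _ | ⟨b, s⟩
      · simp only [insRow, dom_cons]
        exact ⟨by omega, dom_nil _⟩
      · rw [dom_cons] at hd
        rw [insRow, if_neg (by omega)]
        simp only [dom_cons]
        exact ⟨by omega, hd.2⟩

/-- standard tableaux -/
def IsTab (T : List (List ℕ)) : Prop :=
  (∀ r ∈ T, r.Pairwise (· < ·)) ∧ T.IsChain dom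

theorem insRow_sorted (x : ℕ) (r : List ℕ) (hs : r.Pairwise (· < ·)) (hx : x ∉ r) :
    (insRow x r).1.Pairwise (· < ·) := by
  rcases h : insRow x r with ⟨r', _ | y⟩
  · have h1 := insRow_none x r r' h
    have h2 := insRow_none_le x r r' h
    simp only [h1, List.pairwise_append]
    refine ⟨hs, by simp, ?_⟩
    intro a ha b hb
    rw [List.mem_singleton] at hb
    subst hb
    exact lt_of_le_of_ne (h2 a ha) fun h => hx (h ▸ ha)
  · obtain ⟨L, D, rfl, rfl, h3, h4⟩ := insRow_some x y r r' h
    simp only [List.pairwise_append, List.pairwise_cons, List.mem_cons] at hs ⊢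
    refine ⟨hs.1, ⟨fun a ha => h4.trans (hs.2.1.1 a ha), hs.2.1.2⟩, ?_⟩
    rintro a ha b (rfl | hb)
    · exact lt_of_le_of_ne (h3 a ha) fun h => hx (by rw [← h]; simp [ha])
    · exact hs.2.2 a ha b (Or.inr hb)

theorem insTab_head (T : List (List ℕ)) (x : ℕ) :
    ∃ T', insTab T x = (insRow x (T.headD [])).1 :: T' := by
  rcases T with _ | ⟨r, T⟩
  · exact ⟨[], by simp [insTab, insRow]⟩
  · rw [insTab]
    rcases h : insRow x r with ⟨r', _ | y⟩
    · exact ⟨T, by simp [h]⟩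
    · exact ⟨insTab T y, by simp [h]⟩

theorem chain_cons_iff (r : List ℕ) (T : List (List ℕ)) :
    (r :: T).IsChain dom ↔ dom r (T.headD []) ∧ T.IsChain dom := by
  rcases T with _ | ⟨s, T⟩
  · simp [dom_nil]
  · simp [List.isChain_cons_cons]

theorem insTab_spec (T : List (List ℕ)) (x : ℕ) (hT : IsTab T) (hnd : (rd T ++ [x]).Nodup) :
    IsTab (insTab T x) ∧ KEq (rd T ++ [x]) (rd (insTab T x)) := by
  induction T generalizing x with
  | nil =>
    refine ⟨⟨by simp [insTab], by simp [insTab]⟩, ?_⟩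
    exact KEq.refl' _
  | cons r T ih =>
    have hr : r.Pairwise (· < ·) := hT.1 r (by simp)
    have hch := (chain_cons_iff r T).mp hT.2
    have hT' : IsTab T := ⟨fun s hs => hT.1 s (by simp [hs]), hch.2⟩
    have hx : x ∉ r := by
      intro hx
      have := (List.nodup_append.mp hnd).2.2 x (by simp [rd, hx]) x (by simp)
      exact this rfl
    have hsrt := insRow_sorted x r hr hx
    rw [insTab]
    rcases h : insRow x r with ⟨r', _ | y⟩
    · rw [h] at hsrt
      have h1 := insRow_none x r r' h
      refine ⟨⟨?_, ?_⟩, ?_⟩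
      · intro s hs
        rcases List.mem_cons.mp hs with rfl | hs
        · exact hsrt
        · exact hT'.1 s hs
      · show (r' :: T).IsChain dom
        rw [chain_cons_iff, h1]
        exact ⟨dom_append hch.1 _, hch.2⟩
      · show KEq _ (rd (r' :: T))
        rw [rd, rd, h1, List.append_assoc]
        exact KEq.refl' _
    · rw [h] at hsrt
      have hk := row_knuth x y r r' hr hx h
      have hk2 := hk.app (rd T) []
      simp only [List.append_nil] at hk2
      have hnd2 : (rd T ++ (y :: r')).Nodup := by
        rw [← hk2.perm.nodup_iff]
        simpa [rd] using hnd
      have hnd3 : (rd T ++ [y]).Nodup := by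
        have : (rd T ++ [y]).Sublist (rd T ++ (y :: r')) :=
          List.Sublist.append_left (by simp) _
        exact hnd2.sublist this
      obtain ⟨i1, i2⟩ := ih y hT' hnd3
      refine ⟨⟨?_, ?_⟩, ?_⟩
      · intro s hs
        rcases List.mem_cons.mp hs with rfl | hs
        · exact hsrt
        · exact i1.1 s hs
      · show (r' :: insTab T y).IsChain dom
        rw [chain_cons_iff]
        refine ⟨?_, i1.2⟩
        obtain ⟨T', hT'⟩ := insTab_head T y
        rw [hT']
        exact dom_ins_ins h hch.1
      · show KEq _ (rd (r' :: insTab T y))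
        have h3 := i2.app [] r'
        simp only [List.nil_append, List.append_assoc] at h3
        rw [rd, rd, List.append_assoc]
        exact hk2.trans' h3

theorem foldl_spec (w : List ℕ) (T : List (List ℕ)) (hT : IsTab T) (hnd : (rd T ++ w).Nodup) :
    IsTab (w.foldl insTab T) ∧ KEq (rd T ++ w) (rd (w.foldl insTab T)) := by
  induction w generalizing T with
  | nil => simpa using ⟨hT, KEq.refl' _⟩
  | cons x w ih =>
    have hnd1 : (rd T ++ [x]).Nodup :=
      hnd.sublist (List.Sublist.append_left (by simp) _)
    obtain ⟨h1, h2⟩ := insTab_spec T x hT hnd1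
    have h3 := h2.app [] w
    simp only [List.nil_append, List.append_assoc, List.singleton_append] at h3
    have hnd2 : (rd (insTab T x) ++ w).Nodup := h3.perm.nodup_iff.mp hnd
    obtain ⟨h4, h5⟩ := ih (insTab T x) h1 hnd2
    exact ⟨h4, h3.trans' h5⟩
end


section
/-- column index of an entry -/
def colT : List (List ℕ) → ℕ → ℕ
  | [], _ => 0
  | r :: T, v => if v ∈ r then r.idxOf v else colT T v

theorem mem_rd (T : List (List ℕ)) (v : ℕ) : v ∈ rd T ↔ ∃ r ∈ T, v ∈ r := by
  induction T with
  | nil => simp [rd]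
  | cons r T ih => simp [rd, ih, or_comm]

theorem IsTab.tail {r : List ℕ} {T : List (List ℕ)} (h : IsTab (r :: T)) : IsTab T :=
  ⟨fun s hs => h.1 s (by simp [hs]), ((chain_cons_iff r T).mp h.2).2⟩

theorem IsTab.dom {r : List ℕ} {T : List (List ℕ)} (h : IsTab (r :: T)) :
    ∀ s ∈ T, dom r s := by
  have h2 := List.isChain_iff_pairwise.mp h.2
  exact (List.pairwise_cons.mp h2).1

theorem colT_at (T : List (List ℕ)) (v : ℕ) (h : v ∈ rd T) :
    ∃ r ∈ T, r[colT T v]? = some v := by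
  induction T with
  | nil => simp [rd] at h
  | cons r T ih =>
    rw [colT]
    split_ifs with hv
    · exact ⟨r, by simp, List.getElem?_idxOf hv⟩
    · have : v ∈ rd T := by
        rw [rd, List.mem_append] at h
        exact h.resolve_right hv
      obtain ⟨s, hs, h1⟩ := ih this
      exact ⟨s, by simp [hs], h1⟩

theorem idx_eq {r : List ℕ} (hr : r.Nodup) {c v : ℕ} (h : r[c]? = some v) : r.idxOf v = c := by
  obtain ⟨hc, rfl⟩ := List.getElem?_eq_some_iff.mp h
  exact hr.idxOf_getElem c hc

theorem colT_eq (T : List (List ℕ)) (hnd : (rd T).Nodup) (r : List ℕ) (hr : r ∈ T) (c v : ℕ)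
    (h : r[c]? = some v) : colT T v = c := by
  induction T with
  | nil => simp at hr
  | cons s T ih =>
    rw [rd, List.nodup_append] at hnd
    have hv : v ∈ r := List.mem_of_getElem? h
    rw [colT]
    split_ifs with hvs
    · rcases List.mem_cons.mp hr with rfl | hr
      · exact idx_eq hnd.2.1 h
      · exact absurd rfl (hnd.2.2 v ((mem_rd T v).mpr ⟨r, hr, hv⟩) v hvs)
    · rcases List.mem_cons.mp hr with rfl | hr
      · exact absurd hv hvs
      · exact ih hnd.1 hr

theorem row_unique (T : List (List ℕ)) (hnd : (rd T).Nodup) (r s : List ℕ) (hr : r ∈ T) (hs : s ∈ T)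
    (v : ℕ) (hvr : v ∈ r) (hvs : v ∈ s) : r = s := by
  induction T with
  | nil => simp at hr
  | cons t T ih =>
    rw [rd, List.nodup_append] at hnd
    rcases List.mem_cons.mp hr with h1 | h1 <;> rcases List.mem_cons.mp hs with h2 | h2
    · rw [h1, h2]
    · subst h1
      exact absurd rfl (hnd.2.2 v ((mem_rd T v).mpr ⟨s, h2, hvs⟩) v hvr)
    · subst h2
      exact absurd rfl (hnd.2.2 v ((mem_rd T v).mpr ⟨r, h1, hvr⟩) v hvs)
    · exact ih hnd.1 h1 h2

theorem sorted_lt {r : List ℕ} (hr : r.Pairwise (· < ·)) {i j a b : ℕ} (hij : i < j)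
    (ha : r[i]? = some a) (hb : r[j]? = some b) : a < b := by
  obtain ⟨hi, rfl⟩ := List.getElem?_eq_some_iff.mp ha
  obtain ⟨hj, rfl⟩ := List.getElem?_eq_some_iff.mp hb
  exact List.pairwise_iff_getElem.mp hr i j hi hj hij

theorem pre_col (T : List (List ℕ)) (hT : IsTab T) (a b : ℕ) (hab : a < b) (h : pre a b (rd T)) :
    ∃ r ∈ T, ∃ s ∈ T, ∃ i j : ℕ, i < j ∧ r[i]? = some a ∧ s[j]? = some b := by
  induction T with
  | nil => exact h.elim
  | cons t T ih =>
    rw [rd, pre_append] at h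
    rcases h with h | h | ⟨h1, h2⟩
    · obtain ⟨r, hr, s, hs, i, j, h3⟩ := ih hT.tail h
      exact ⟨r, by simp [hr], s, by simp [hs], i, j, h3⟩
    · obtain ⟨i, j, h3⟩ := (pre_iff a b t).mp h
      exact ⟨t, by simp, t, by simp, i, j, h3⟩
    · obtain ⟨s, hs, has⟩ := (mem_rd T a).mp h1
      obtain ⟨i, hi⟩ := List.mem_iff_getElem?.mp has
      obtain ⟨j, hj⟩ := List.mem_iff_getElem?.mp h2
      refine ⟨s, by simp [hs], t, by simp, i, j, ?_, hi, hj⟩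
      by_contra hle
      obtain ⟨a', ha', hlt⟩ := hT.dom s hs i a hi
      rcases Nat.lt_or_ge j i with hji | hji
      · have := sorted_lt (hT.1 t (by simp)) hji hj ha'
        omega
      · have : i = j := by omega
        subst this
        rw [ha'] at hj
        have := Option.some.inj hj
        omega

theorem pre_row (T : List (List ℕ)) (r : List ℕ) (hr : r ∈ T) (a b : ℕ) (h : pre a b r) :
    pre a b (rd T) := by
  induction T with
  | nil => simp at hr
  | cons t T ih =>
    rw [rd, pre_append]
    rcases List.mem_cons.mp hr with rfl | hr
    · exact Or.inr (Or.inl h)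
    · exact Or.inl (ih hr)

/-- number of entries less than `k` in columns of index at least `m` -/
def cntT (n : ℕ) (T : List (List ℕ)) (k m : ℕ) : ℕ :=
  (Finset.univ.filter fun v : Fin n => (v : ℕ) < k ∧ m ≤ colT T v).card

theorem tab_Bd {n : ℕ} (T : List (List ℕ)) (hT : IsTab T) (hp : (rd T).Perm (List.range n))
    (k m : ℕ) : Bd (Rw n (rd T)) k m (cntT n T k m) ∧
      ∀ c, Bd (Rw n (rd T)) k m c → cntT n T k m ≤ c := by
  classical
  have hnd : (rd T).Nodup := hp.nodup_iff.mpr List.nodup_range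
  have hmem : ∀ v, v ∈ rd T ↔ v < n := fun v => by rw [hp.mem_iff, List.mem_range]
  constructor
  · intro N hN
    apply rank_upper N (fun v => colT T v)
    intro i j hij
    by_contra hc
    apply hij
    apply hN
    rintro ⟨h1, h2⟩
    obtain ⟨r, hr, s, hs, a, b, hab, ha, hb⟩ := pre_col T hT i j h1 h2
    rw [colT_eq T hnd r hr a i ha, colT_eq T hnd s hs b j hb] at hc
    exact hc hab
  · intro c hc
    have hprev : ∀ v : Fin n, ∃ u : Fin n, 0 < colT T v →
        ∃ r ∈ T, ∃ i, r[i]? = some (u : ℕ) ∧ r[i + 1]? = some (v : ℕ) := by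
      intro v
      by_cases h0 : 0 < colT T v
      · obtain ⟨r, hr, h1⟩ := colT_at T v ((hmem v).mpr v.2)
        obtain ⟨i, hi⟩ : ∃ i, colT T v = i + 1 := ⟨colT T v - 1, by omega⟩
        rw [hi] at h1
        obtain ⟨hlt, _⟩ := List.getElem?_eq_some_iff.mp h1
        have hu : r[i]? = some r[i] := List.getElem?_eq_getElem (by omega)
        have hun : r[i] < n := (hmem _).mp ((mem_rd T _).mpr ⟨r, hr, List.getElem_mem _⟩)
        exact ⟨⟨r[i], hun⟩, fun _ => ⟨r, hr, i, hu, h1⟩⟩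
      · exact ⟨v, fun h => absurd h h0⟩
    choose prev hprev using hprev
    refine (rank_lower (fun v => colT T v) prev ?_ ?_ m k).trans (hc _ ?_)
    · intro v hv
      obtain ⟨r, hr, i, h1, h2⟩ := hprev v hv
      show colT T (prev v) + 1 = colT T v
      rw [colT_eq T hnd r hr _ _ h1, colT_eq T hnd r hr _ _ h2]
    · intro v w hv hw he
      obtain ⟨r, hr, i, h1, h2⟩ := hprev v hv
      obtain ⟨s, hs, j, h3, h4⟩ := hprev w hw
      rw [← he] at h3
      have hrs := row_unique T hnd r s hr hs _ (List.mem_of_getElem? h1) (List.mem_of_getElem? h3)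
      have e1 := colT_eq T hnd r hr _ _ h1
      have e2 := colT_eq T hnd s hs _ _ h3
      have hij : i = j := e1.symm.trans e2
      subst hrs hij
      rw [h2] at h4
      exact Fin.ext (Option.some.inj h4)
    · intro a b hab
      rw [Matrix.of_apply, if_neg]
      rintro ⟨hb, rfl⟩
      obtain ⟨r, hr, i, h1, h2⟩ := hprev b hb
      apply hab
      refine ⟨sorted_lt (hT.1 r hr) (Nat.lt_succ_self i) h1 h2, ?_⟩
      exact pre_row T r hr _ _ ((pre_iff _ _ _).mpr ⟨i, i + 1, by omega, h1, h2⟩)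

theorem countP_row (r : List ℕ) (hr : r.Nodup) (m : ℕ) :
    r.countP (fun v => decide (m ≤ r.idxOf v)) = r.length - m := by
  have e := List.take_append_drop m r
  have h1 : r.countP (fun v => decide (m ≤ r.idxOf v)) =
      (r.take m).countP (fun v => decide (m ≤ r.idxOf v)) +
      (r.drop m).countP (fun v => decide (m ≤ r.idxOf v)) := by
    rw [← List.countP_append, e]
  have h2 : (r.take m).countP (fun v => decide (m ≤ r.idxOf v)) = 0 := by
    rw [List.countP_eq_zero]
    intro v hv
    obtain ⟨i, hi⟩ := List.mem_iff_getElem?.mp hv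
    rw [List.getElem?_take] at hi
    split_ifs at hi with him
    rw [idx_eq hr hi]
    simpa using him
  have h3 : (r.drop m).countP (fun v => decide (m ≤ r.idxOf v)) = (r.drop m).length := by
    rw [List.countP_eq_length]
    intro v hv
    obtain ⟨i, hi⟩ := List.mem_iff_getElem?.mp hv
    rw [List.getElem?_drop] at hi
    rw [idx_eq hr hi]
    simp
  rw [h1, h2, h3, List.length_drop, zero_add]

theorem countP_tab (T : List (List ℕ)) (hnd : (rd T).Nodup) (m : ℕ) :
    (rd T).countP (fun v => decide (m ≤ colT T v)) = ((shapeOf T).map (fun l => l - m)).sum := by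
  induction T with
  | nil => simp [rd, shapeOf]
  | cons r T ih =>
    have hnd' := hnd
    rw [rd, List.nodup_append] at hnd
    rw [rd, List.countP_append]
    have h1 : (rd T).countP (fun v => decide (m ≤ colT (r :: T) v)) =
        (rd T).countP (fun v => decide (m ≤ colT T v)) := by
      apply List.countP_congr
      intro v hv
      rw [colT, if_neg fun hr => hnd.2.2 v hv v hr rfl]
    have h2 : r.countP (fun v => decide (m ≤ colT (r :: T) v)) =
        r.countP (fun v => decide (m ≤ r.idxOf v)) := by
      apply List.countP_congr
      intro v hv
      rw [colT, if_pos hv]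
    rw [h1, h2, ih hnd.1, countP_row r hnd.2.1]
    simp only [shapeOf, List.map_cons, List.sum_cons]
    omega

theorem cntT_full {n : ℕ} (T : List (List ℕ)) (hp : (rd T).Perm (List.range n)) (m : ℕ) :
    cntT n T n m = ((shapeOf T).map (fun l => l - m)).sum := by
  have hnd : (rd T).Nodup := hp.nodup_iff.mpr List.nodup_range
  rw [← countP_tab T hnd, hp.countP_eq, cntT]
  rw [List.countP_eq_length_filter, ← List.toFinset_card_of_nodup (List.nodup_range.filter _)]
  rw [← Finset.card_map Fin.valEmbedding]
  congr 1
  ext v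
  simp only [Finset.mem_map, Finset.mem_filter, Finset.mem_univ, true_and, List.mem_toFinset,
    List.mem_filter, List.mem_range, decide_eq_true_eq, Fin.valEmbedding_apply]
  constructor
  · rintro ⟨a, h, rfl⟩; exact ⟨a.2, h.2⟩
  · rintro ⟨h1, h2⟩; exact ⟨⟨v, h1⟩, ⟨h1, h2⟩, rfl⟩

theorem colT_of_cnt {n : ℕ} (T T' : List (List ℕ)) (h : ∀ k m, cntT n T k m = cntT n T' k m)
    (v : ℕ) (hv : v < n) : colT T v = colT T' v := by
  classical
  have step : ∀ (T : List (List ℕ)) m, cntT n T (v + 1) m =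
      cntT n T v m + if m ≤ colT T v then 1 else 0 := by
    intro T m
    rw [cntT, cntT]
    split_ifs with hm
    · rw [← Finset.card_insert_of_notMem (a := (⟨v, hv⟩ : Fin n)) (by simp)]
      congr 1
      ext u
      simp only [Finset.mem_filter, Finset.mem_insert, Finset.mem_univ, true_and, Fin.ext_iff]
      constructor
      · rintro ⟨h1, h2⟩
        by_cases hu : (u : ℕ) = v
        · exact Or.inl hu
        · exact Or.inr ⟨by omega, h2⟩
      · rintro (hu | ⟨h1, h2⟩)
        · exact ⟨by omega, by rw [hu]; exact hm⟩
        · exact ⟨by omega, h2⟩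
    · rw [add_zero]
      congr 1
      ext u
      simp only [Finset.mem_filter, Finset.mem_univ, true_and]
      constructor
      · rintro ⟨h1, h2⟩
        refine ⟨?_, h2⟩
        by_contra hu
        have : (u : ℕ) = v := by omega
        rw [this] at h2
        exact hm h2
      · rintro ⟨h1, h2⟩
        exact ⟨by omega, h2⟩
  have key : ∀ m, m ≤ colT T v ↔ m ≤ colT T' v := by
    intro m
    have h1 := step T m
    have h2 := step T' m
    rw [h (v + 1) m, h v m, h2] at h1
    have h3 := Nat.add_left_cancel h1
    split_ifs at h3 with ha hb hb
    · exact ⟨fun _ => ha, fun _ => hb⟩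
    · exact ⟨fun h => absurd h hb, fun h => absurd h ha⟩
  exact le_antisymm ((key _).mp le_rfl) ((key _).mpr le_rfl)

theorem tab_ext (T T' : List (List ℕ)) (hT : IsTab T) (hT' : IsTab T')
    (hsh : shapeOf T = shapeOf T')
    (h : ∀ c v : ℕ, (∃ r ∈ T, r[c]? = some v) ↔ (∃ r ∈ T', r[c]? = some v)) : T = T' := by
  induction T generalizing T' with
  | nil =>
    rcases T' with _ | ⟨r, T'⟩
    · rfl
    · simp [shapeOf] at hsh
  | cons r T ih =>
    rcases T' with _ | ⟨r', T'⟩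
    · simp [shapeOf] at hsh
    · have hsh' : r.length = r'.length ∧ shapeOf T = shapeOf T' := by
        simpa [shapeOf] using hsh
      have aux : ∀ (r r' : List ℕ) (T T' : List (List ℕ)), IsTab (r' :: T') →
          (∀ c v : ℕ, (∃ s ∈ r :: T, s[c]? = some v) → (∃ s ∈ r' :: T', s[c]? = some v)) →
          ∀ c a b : ℕ, r[c]? = some a → r'[c]? = some b → b ≤ a := by
        intro r r' T T' hT' h c a b ha hb
        obtain ⟨s, hs, h1⟩ := h c a ⟨r, by simp, ha⟩
        rcases List.mem_cons.mp hs with rfl | hs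
        · rw [hb] at h1
          exact (Option.some.inj h1).le
        · obtain ⟨b', hb', hlt⟩ := hT'.dom s hs c a h1
          rw [hb] at hb'
          have := Option.some.inj hb'
          omega
      have hrr : r = r' := by
        apply List.ext_getElem hsh'.1
        intro c h1 h2
        apply le_antisymm
        · exact aux r' r T' T hT (fun c v => (h c v).mpr) c _ _ (List.getElem?_eq_getElem h2)
            (List.getElem?_eq_getElem h1)
        · exact aux r r' T T' hT' (fun c v => (h c v).mp) c _ _ (List.getElem?_eq_getElem h1)
            (List.getElem?_eq_getElem h2)
      subst hrr
      have aux2 : ∀ (T T' : List (List ℕ)), IsTab (r :: T) →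
          (∀ c v : ℕ, (∃ s ∈ r :: T, s[c]? = some v) → (∃ s ∈ r :: T', s[c]? = some v)) →
          ∀ c v : ℕ, (∃ s ∈ T, s[c]? = some v) → (∃ s ∈ T', s[c]? = some v) := by
        rintro T T' hT h c v ⟨s, hs, h1⟩
        obtain ⟨s', hs', h2⟩ := h c v ⟨s, by simp [hs], h1⟩
        rcases List.mem_cons.mp hs' with rfl | hs'
        · obtain ⟨a, ha, hlt⟩ := hT.dom s hs c v h1
          rw [ha] at h2
          have := Option.some.inj h2
          omega
        · exact ⟨s', hs', h2⟩
      rw [ih T' hT.tail hT'.tail hsh'.2 fun c v =>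
        ⟨aux2 T T' hT (fun c v => (h c v).mp) c v, aux2 T' T hT' (fun c v => (h c v).mpr) c v⟩]

theorem tab_eq {n : ℕ} (T T' : List (List ℕ)) (hT : IsTab T) (hT' : IsTab T')
    (hp : (rd T).Perm (List.range n)) (hp' : (rd T').Perm (List.range n))
    (hsh : shapeOf T = shapeOf T') (h : ∀ k m, cntT n T k m = cntT n T' k m) : T = T' := by
  have hcol := colT_of_cnt T T' h
  have at_iff : ∀ (T : List (List ℕ)), (rd T).Perm (List.range n) → ∀ c v : ℕ,
      (∃ r ∈ T, r[c]? = some v) ↔ v < n ∧ colT T v = c := by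
    intro T hp c v
    have hnd : (rd T).Nodup := hp.nodup_iff.mpr List.nodup_range
    have hmem : ∀ v, v ∈ rd T ↔ v < n := fun v => by rw [hp.mem_iff, List.mem_range]
    constructor
    · rintro ⟨r, hr, h⟩
      exact ⟨(hmem v).mp ((mem_rd T v).mpr ⟨r, hr, List.mem_of_getElem? h⟩),
        colT_eq T hnd r hr c v h⟩
    · rintro ⟨h1, rfl⟩
      exact colT_at T v ((hmem v).mpr h1)
  apply tab_ext T T' hT hT' hsh
  intro c v
  rw [at_iff T hp, at_iff T' hp']
  constructor
  · rintro ⟨h1, h2⟩; exact ⟨h1, by rw [← hcol v h1, h2]⟩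
  · rintro ⟨h1, h2⟩; exact ⟨h1, by rw [hcol v h1, h2]⟩

theorem shape_sorted (T : List (List ℕ)) (hT : IsTab T) : (shapeOf T).Pairwise (· ≥ ·) := by
  have h2 := List.isChain_iff_pairwise.mp hT.2
  rw [shapeOf, List.pairwise_map]
  exact h2.imp fun h => dom_length h

theorem sum_le_sub (l : List ℕ) (m : ℕ) : l.sum ≤ (l.map (fun x => x - m)).sum + l.length * m := by
  induction l with
  | nil => simp
  | cons a l ih =>
    simp only [List.sum_cons, List.map_cons, List.length_cons, Nat.add_mul, one_mul]
    omega

theorem sum_eq_sub (l : List ℕ) (m : ℕ) (h : ∀ x ∈ l, m ≤ x) :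
    l.sum = (l.map (fun x => x - m)).sum + l.length * m := by
  induction l with
  | nil => simp
  | cons a l ih =>
    have h1 := ih fun x hx => h x (by simp [hx])
    have h2 := h a (by simp)
    simp only [List.sum_cons, List.map_cons, List.length_cons, Nat.add_mul, one_mul]
    omega

theorem dom_of_excess (a b : List ℕ) (hb : b.Pairwise (· ≥ ·))
    (h : ∀ m, (a.map (fun x => x - m)).sum ≤ (b.map (fun x => x - m)).sum) : domList a b := by
  intro i
  have hsplit : ∀ (l : List ℕ) m, (l.map (fun x => x - m)).sum =
      ((l.take i).map (fun x => x - m)).sum + ((l.drop i).map (fun x => x - m)).sum := by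
    intro l m
    rw [← List.sum_append, ← List.map_append, List.take_append_drop]
  rcases Nat.lt_or_ge i b.length with hi | hi
  · have h0 := h b[i]
    rw [hsplit a, hsplit b] at h0
    have h1 := sum_le_sub (a.take i) b[i]
    have h2 := sum_eq_sub (b.take i) b[i] (by
      intro x hx
      obtain ⟨j, hj⟩ := List.mem_iff_getElem?.mp hx
      rw [List.getElem?_take] at hj
      split_ifs at hj with hji
      obtain ⟨hlt, rfl⟩ := List.getElem?_eq_some_iff.mp hj
      exact List.pairwise_iff_getElem.mp hb j i hlt hi hji)
    have h3 : ((b.drop i).map (fun x => x - b[i])).sum = 0 := by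
      rw [List.sum_eq_zero_iff]
      intro x hx
      obtain ⟨y, hy, rfl⟩ := List.mem_map.mp hx
      obtain ⟨j, hj⟩ := List.mem_iff_getElem?.mp hy
      rw [List.getElem?_drop] at hj
      obtain ⟨hlt, rfl⟩ := List.getElem?_eq_some_iff.mp hj
      rcases Nat.eq_zero_or_pos j with rfl | hj0
      · simp
      · have := List.pairwise_iff_getElem.mp hb i (i + j) hi hlt (by omega)
        simp only [ge_iff_le] at this
        omega
    have h4 : (a.take i).length * b[i] ≤ (b.take i).length * b[i] := by
      apply Nat.mul_le_mul_right
      simp only [List.length_take]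
      omega
    omega
  · have h0 := h 0
    simp only [Nat.sub_zero, List.map_id'] at h0
    rw [List.take_of_length_le hi]
    refine le_trans ?_ h0
    exact (List.take_sublist i a).sum_le_sum (by simp)
end


theorem generic_rank {n : ℕ} (R : Fin n → Fin n → Prop) (M : Matrix (Fin n) (Fin n) (PolA n))
    (h0 : ∀ a b, ¬ R a b → M a b = 0)
    (h1 : ∀ N : Matrix (Fin n) (Fin n) ℚ, (∀ a b, ¬ R a b → N a b = 0) →
      ∃ p : Option (Fin n × Fin n) → ℚ, M.map (MvPolynomial.eval p) = N)
    (k j c : ℕ) (hB : Bd R k j c) (hmin : ∀ c', Bd R k j c' → c ≤ c') :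
    ((M.map (algebraMap (PolA n) (KK n))) ^ j * Pm (KK n) n k).rank = c := by
  apply le_antisymm
  · obtain ⟨p, hp⟩ := exists_spec (algebraMap (PolA n) (KK n)) (M ^ j * Pm (PolA n) n k)
    rw [powP_map, powP_map] at hp
    refine hp.trans (hB _ ?_)
    intro a b hab
    rw [Matrix.map_apply, h0 a b hab, map_zero]
  · apply hmin
    intro N hN
    obtain ⟨p, rfl⟩ := h1 N hN
    rw [← powP_map, ← powP_map]
    exact rank_map_le_map _ _ (IsFractionRing.injective (PolA n) (KK n)) _

theorem generic_Nt {n : ℕ} (Rs Rr : Fin n → Fin n → Prop) (hrs : ∀ i j, Rr i j → Rs i j)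
    (k j c : ℕ) (hB : Bd Rs k j c) (hmin : ∀ c', Bd Rs k j c' → c ≤ c') :
    (((Nt Rs Rr).map (algebraMap (PolA n) (KK n))) ^ j * Pm (KK n) n k).rank = c := by
  classical
  apply generic_rank Rs (Nt Rs Rr) _ _ k j c hB hmin
  · intro a b hab
    have h' : ¬ Rr a b := fun h => hab (hrs a b h)
    simp [Nt, hab, h']
  · intro N hN
    refine ⟨fun o => o.elim 1 fun p => N p.1 p.2, ?_⟩
    ext a b
    rw [Matrix.map_apply, Nt, Matrix.of_apply]
    split_ifs with h1 h2
    · simp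
    · simp
    · rw [map_zero, hN a b h2]

theorem generic_Nt0 {n : ℕ} (Rs Rr : Fin n → Fin n → Prop)
    (k j c : ℕ) (hB : Bd Rr k j c) (hmin : ∀ c', Bd Rr k j c' → c ≤ c') :
    (((Nt Rs Rr).map ((algebraMap (PolA n) (KK n)).comp (sp n))) ^ j * Pm (KK n) n k).rank = c := by
  classical
  have e : (Nt Rs Rr).map ((algebraMap (PolA n) (KK n)).comp (sp n)) =
    ((Nt Rs Rr).map (sp n)).map (algebraMap (PolA n) (KK n)) := by
    ext a b; rfl
  have h0 : ∀ a b, ((Nt Rs Rr).map (sp n)) a b =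
      if Rr a b then MvPolynomial.X (some (a, b)) else 0 := by
    intro a b
    rw [Matrix.map_apply, Nt, Matrix.of_apply]
    split_ifs with h1 h2
    · rw [sp_some]
    · rw [map_mul, sp_none, zero_mul]
    · rw [map_zero]
  rw [e]
  apply generic_rank Rr _ _ _ k j c hB hmin
  · intro a b hab
    rw [h0, if_neg hab]
  · intro N hN
    refine ⟨fun o => o.elim 1 fun p => N p.1 p.2, ?_⟩
    ext a b
    rw [Matrix.map_apply, h0]
    split_ifs with h1
    · simp
    · rw [map_zero, hN a b h1]

theorem Rw_word {n : ℕ} (σ : Equiv.Perm (Fin n)) (a b : Fin n) :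
    Rw n (List.ofFn fun i => (σ i : ℕ)) a b ↔ a < b ∧ σ⁻¹ a < σ⁻¹ b := by
  rw [Rw, pre_iff]
  refine and_congr_right fun _ => ?_
  have key : ∀ (i : ℕ) (c : Fin n), (List.ofFn fun i => (σ i : ℕ))[i]? = some (c : ℕ) ↔
      ((σ⁻¹ c : Fin n) : ℕ) = i := by
    intro i c
    rw [List.getElem?_eq_some_iff]
    constructor
    · rintro ⟨h, hc⟩
      rw [List.getElem_ofFn] at hc
      have := Fin.ext hc
      rw [← this]
      simp
    · rintro rfl
      exact ⟨by simp, by simp⟩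
  constructor
  · rintro ⟨i, j, hij, h1, h2⟩
    rw [key] at h1 h2
    rw [Fin.lt_def, h1, h2]; exact hij
  · intro h
    exact ⟨_, _, h, (key _ _).mpr rfl, (key _ _).mpr rfl⟩

theorem word_perm {n : ℕ} (σ : Equiv.Perm (Fin n)) :
    (List.ofFn fun i => (σ i : ℕ)).Perm (List.range n) := by
  rw [List.perm_ext_iff_of_nodup _ List.nodup_range]
  · intro a
    rw [List.mem_ofFn, List.mem_range]
    constructor
    · rintro ⟨i, rfl⟩; exact (σ i).2
    · intro h; exact ⟨σ⁻¹ ⟨a, h⟩, by simp⟩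
  · rw [List.nodup_ofFn]
    intro i j h
    exact σ.injective (Fin.ext h)

theorem Ptab_spec {n : ℕ} (σ : Equiv.Perm (Fin n)) :
    IsTab (Ptab σ) ∧ (rd (Ptab σ)).Perm (List.range n) ∧
    ∀ k m, Bd (Rw n (List.ofFn fun i => (σ i : ℕ))) k m (cntT n (Ptab σ) k m) ∧
      ∀ c, Bd (Rw n (List.ofFn fun i => (σ i : ℕ))) k m c → cntT n (Ptab σ) k m ≤ c := by
  have hp := word_perm σ
  have hnd : (List.ofFn fun i => (σ i : ℕ)).Nodup := hp.nodup_iff.mpr List.nodup_range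
  obtain ⟨h1, h2⟩ := foldl_spec (List.ofFn fun i => (σ i : ℕ)) [] ⟨by simp, by simp⟩ hnd
  have h3 : KEq (List.ofFn fun i => (σ i : ℕ)) (rd (Ptab σ)) := h2
  have hp2 := h3.perm.symm.trans hp
  refine ⟨h1, hp2, fun k m => ?_⟩
  have h4 := fun c => KEq_Bd (n := n) h3 hnd
    (fun a ha => List.mem_range.mp (hp.mem_iff.mp ha)) k m c
  have h5 := tab_Bd (Ptab σ) h1 hp2 k m
  exact ⟨(h4 _).mpr h5.1, fun c hc => h5.2 c ((h4 c).mp hc)⟩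

theorem Pm_full (K : Type*) [CommRing K] (n : ℕ) : Pm K n n = 1 := by
  rw [Pm, ← Matrix.diagonal_one]
  congr 1
  funext i
  simp

/-- For `σ ≤_R ρ` in the right weak Bruhat order, either `P(σ) = P(ρ)`, or the shape of
the insertion tableau of `ρ` is strictly smaller than the shape of the insertion tableau
of `σ` in the dominance order. -/
theorem shape_drop_along_right_order {n : ℕ} (σ ρ : Equiv.Perm (Fin n)) (h : rLE σ ρ) :
    Ptab σ = Ptab ρ ∨
    (domList (shapeOf (Ptab ρ)) (shapeOf (Ptab σ)) ∧
      shapeOf (Ptab ρ) ≠ shapeOf (Ptab σ)) := by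
  obtain ⟨s1, s2, s3⟩ := Ptab_spec σ
  obtain ⟨r1, r2, r3⟩ := Ptab_spec ρ
  set Rs := Rw n (List.ofFn fun i => (σ i : ℕ)) with hRs
  set Rr := Rw n (List.ofFn fun i => (ρ i : ℕ)) with hRr
  have hrs : ∀ i j, Rr i j → Rs i j := by
    intro i j hij
    rw [hRr, Rw_word] at hij
    rw [hRs, Rw_word]
    refine ⟨hij.1, ?_⟩
    by_contra hc
    have hne : σ⁻¹ j ≠ σ⁻¹ i := fun h => hij.1.ne' (σ⁻¹.injective h)
    have hm : (j, i) ∈ InvR σ := ⟨hij.1, lt_of_le_of_ne (not_lt.mp hc) hne⟩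
    have := (h hm).2
    exact absurd hij.2 (not_lt.mpr this.le)
  have hle : ∀ k m, cntT n (Ptab ρ) k m ≤ cntT n (Ptab σ) k m :=
    fun k m => (r3 k m).2 _ ((s3 k m).1.mono hrs)
  by_cases hsh : shapeOf (Ptab ρ) = shapeOf (Ptab σ)
  · left
    have hg1 : ∀ k j, _ := fun k j =>
      generic_Nt Rs Rr hrs k j _ (s3 k j).1 (s3 k j).2
    have hg0 : ∀ k j, _ := fun k j =>
      generic_Nt0 Rs Rr k j _ (r3 k j).1 (r3 k j).2
    apply tab_eq (Ptab σ) (Ptab ρ) s1 r1 s2 r2 hsh.symm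
    intro k m
    apply le_antisymm _ (hle k m)
    rw [← hg1 k m, ← hg0 k m]
    apply partI Rs Rr (fun i => ρ⁻¹ i) (fun i j hij => hij.1) hrs (Rw_word ρ)
    intro j
    have a1 := hg1 n j
    have a0 := hg0 n j
    rw [Pm_full, mul_one] at a1 a0
    rw [a1, a0, cntT_full _ s2, cntT_full _ r2, hsh]
  · right
    refine ⟨dom_of_excess _ _ (shape_sorted _ s1) fun m => ?_, hsh⟩
    rw [← cntT_full _ s2, ← cntT_full _ r2]
    exact hle n m
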